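/- arXiv:0802.3930 — 3 statements merged into one kernel-verified Lean document; each statement's English description precedes it below -/
import Mathlib

section
/- Let 0 < α < 1 and let f ∈ H_α[0,1] satisfy γ(f) = 1. Then there exists a constant C(f,α) > 0 such that log Γ_n(f) ≤ C(f,α) · n^{1−α} for all n ∈ ℕ. -/
open Set Filter

/-- The sup norm over `[0,1]` of the derivative (within `[0,1]`) of a map. -/
noncomputable def supAbsDeriv (f : ℝ → ℝ) : ℝ :=
  sSup ((fun x => |derivWithin f (Set.Icc (0:ℝ) 1) x|) '' Set.Icc (0:ℝ) 1)

/-- `IsDiff01 f g` says that `f` is a `C¹` diffeomorphism of `[0,1]` fixing `0` and `1`,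
with everywhere positive derivative, and `g` is its inverse. -/
structure IsDiff01 (f g : ℝ → ℝ) : Prop where
  mapsTo : Set.MapsTo f (Set.Icc (0:ℝ) 1) (Set.Icc (0:ℝ) 1)
  inv_mapsTo : Set.MapsTo g (Set.Icc (0:ℝ) 1) (Set.Icc (0:ℝ) 1)
  left_inv : ∀ x ∈ Set.Icc (0:ℝ) 1, g (f x) = x
  right_inv : ∀ x ∈ Set.Icc (0:ℝ) 1, f (g x) = x
  map_zero : f 0 = 0
  map_one : f 1 = 1
  contDiffOn : ContDiffOn ℝ 1 f (Set.Icc (0:ℝ) 1)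
  inv_contDiffOn : ContDiffOn ℝ 1 g (Set.Icc (0:ℝ) 1)
  deriv_pos : ∀ x ∈ Set.Icc (0:ℝ) 1, 0 < derivWithin f (Set.Icc (0:ℝ) 1) x

/-- The growth sequence `Γ_n(f) = max (‖(fⁿ)'‖_∞, ‖(f⁻ⁿ)'‖_∞)`, where `g = f⁻¹`. -/
noncomputable def Gamma (f g : ℝ → ℝ) (n : ℕ) : ℝ :=
  max (supAbsDeriv (f^[n])) (supAbsDeriv (g^[n]))

/-- `γ(f) = lim_n Γ_n(f)^(1/n) = 1`, where `g = f⁻¹`. -/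
def GammaEqOne (f g : ℝ → ℝ) : Prop :=
  Filter.Tendsto (fun n : ℕ => (Gamma f g n) ^ (1/(n:ℝ))) Filter.atTop (nhds 1)

/-- A modulus of continuity: continuous, non-decreasing, nonnegative on `[0,1]`,
vanishing at `0`, and subadditive. -/
structure IsModCont (ω : ℝ → ℝ) : Prop where
  continuousOn : ContinuousOn ω (Set.Icc (0:ℝ) 1)
  monotoneOn : MonotoneOn ω (Set.Icc (0:ℝ) 1)
  nonneg : ∀ x ∈ Set.Icc (0:ℝ) 1, 0 ≤ ω x
  map_zero : ω 0 = 0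
  subadd : ∀ a b : ℝ, 0 ≤ a → 0 ≤ b → a + b ≤ 1 → ω (a + b) ≤ ω a + ω b

/-- Membership in `Diff₀^ω[0,1]`: the derivative of `f` has modulus of continuity
controlled by `ω` up to a multiplicative constant. -/
def InDiffOmega (ω f : ℝ → ℝ) : Prop :=
  ∃ C > 0, ∀ x ∈ Set.Icc (0:ℝ) 1, ∀ y ∈ Set.Icc (0:ℝ) 1,
    |derivWithin f (Set.Icc (0:ℝ) 1) x - derivWithin f (Set.Icc (0:ℝ) 1) y| ≤ C * ω |x - y|

/-- Iterates of maps `[0,1] → [0,1]` obey the chain rule within `[0,1]`. -/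
theorem hasDerivWithinAt_iterate_prod {f F : ℝ → ℝ} {s : Set ℝ} (hm : MapsTo f s s)
    (hd : ∀ x ∈ s, HasDerivWithinAt f (F x) s x) (n : ℕ) {x : ℝ} (hx : x ∈ s) :
    HasDerivWithinAt f^[n] (∏ k ∈ Finset.range n, F (f^[k] x)) s x := by
  induction n with
  | zero => simpa using hasDerivWithinAt_id x s
  | succ n ih =>
    rw [Function.iterate_succ', Finset.prod_range_succ, mul_comm]
    exact (hd _ (hm.iterate n hx)).comp x ih (hm.iterate n)

theorem mul_eq_one_of_hasDerivWithinAt_inverse {φ ψ : ℝ → ℝ} {a b y : ℝ}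
    (hy : y ∈ Icc (0:ℝ) 1) (hψm : MapsTo ψ (Icc (0:ℝ) 1) (Icc (0:ℝ) 1))
    (hφ : HasDerivWithinAt φ a (Icc (0:ℝ) 1) (ψ y))
    (hψ : HasDerivWithinAt ψ b (Icc (0:ℝ) 1) y)
    (hinv : ∀ z ∈ Icc (0:ℝ) 1, φ (ψ z) = z) : a * b = 1 := by
  have h1 := hφ.comp y hψ hψm
  have h2 : HasDerivWithinAt (φ ∘ ψ) 1 (Icc (0:ℝ) 1) y :=
    (hasDerivWithinAt_id y _).congr (fun z hz => hinv z hz) (hinv y hy)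
  exact (uniqueDiffOn_Icc zero_lt_one y hy).eq_deriv _ h1 h2

theorem exists_sub_eq_mul_of_hasDerivWithinAt_Icc {f F : ℝ → ℝ}
    (hd : ∀ x ∈ Icc (0:ℝ) 1, HasDerivWithinAt f (F x) (Icc (0:ℝ) 1) x) {a b : ℝ}
    (ha : a ∈ Icc (0:ℝ) 1) (hb : b ∈ Icc (0:ℝ) 1) (hab : a < b) :
    ∃ c ∈ Ioo a b, f b - f a = F c * (b - a) := by
  have hsub : Icc a b ⊆ Icc (0:ℝ) 1 := Icc_subset_Icc ha.1 hb.2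
  obtain ⟨c, hc, h⟩ := exists_hasDerivAt_eq_slope f F hab
    (fun x hx => ((hd x (hsub hx)).continuousWithinAt).mono hsub)
    (fun x hx => (hd x (hsub (Ioo_subset_Icc_self hx))).hasDerivAt
      (Icc_mem_nhds (ha.1.trans_lt hx.1) (hx.2.trans_le hb.2)))
  refine ⟨c, hc, ?_⟩
  rw [h, div_mul_cancel₀ _ (sub_ne_zero.2 hab.ne')]

theorem abs_log_sub_log_le {a b m : ℝ} (hm : 0 < m) (ha : m ≤ a) (hb : m ≤ b) :
    |Real.log a - Real.log b| ≤ |a - b| / m := by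
  have key : ∀ a b : ℝ, m ≤ a → m ≤ b → Real.log a - Real.log b ≤ |a - b| / m := by
    intro a b ha hb
    have ha0 := hm.trans_le ha
    have hb0 := hm.trans_le hb
    rw [← Real.log_div ha0.ne' hb0.ne']
    calc Real.log (a / b) ≤ a / b - 1 := Real.log_le_sub_one_of_pos (by positivity)
      _ = (a - b) / b := by field_simp
      _ ≤ |a - b| / b := by gcongr; exact le_abs_self _
      _ ≤ |a - b| / m := by gcongr
  rw [abs_le]
  have h1 := key a b ha hb
  have h2 := key b a hb ha
  rw [abs_sub_comm] at h2
  constructor <;> linarith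

/-- Jensen's inequality for `t ↦ t ^ α` and a sequence of total mass at most one. -/
theorem sum_rpow_le_rpow_of_sum_le_one {α : ℝ} (hα0 : 0 < α) (hα1 : α < 1) {l : ℕ → ℝ}
    (hl : ∀ k, 0 ≤ l k) {n : ℕ} (hn : 1 ≤ n) (hsum : ∑ k ∈ Finset.range n, l k ≤ 1) :
    ∑ k ∈ Finset.range n, l k ^ α ≤ (n:ℝ) ^ (1 - α) := by
  have hn0 : (0:ℝ) < n := by exact_mod_cast hn
  have h1 : ∀ k, (n:ℝ) ^ α * l k ^ α ≤ α * (n * l k) + (1 - α) := by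
    intro k
    have := Real.geom_mean_le_arith_mean2_weighted hα0.le (sub_nonneg.2 hα1.le)
      (mul_nonneg hn0.le (hl k)) zero_le_one (by ring)
    rwa [Real.one_rpow, mul_one, mul_one, Real.mul_rpow hn0.le (hl k)] at this
  have h2 : (n:ℝ) ^ α * ∑ k ∈ Finset.range n, l k ^ α ≤ n := by
    rw [Finset.mul_sum]
    calc _ ≤ ∑ k ∈ Finset.range n, (α * (n * l k) + (1 - α)) :=
          Finset.sum_le_sum fun k _ => h1 k
      _ = α * n * ∑ k ∈ Finset.range n, l k + n * (1 - α) := by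
          rw [Finset.sum_add_distrib, Finset.mul_sum]; simp [mul_assoc, mul_sub]
      _ ≤ α * n * 1 + n * (1 - α) := by gcongr
      _ = n := by ring
  rw [Real.rpow_sub hn0, Real.rpow_one, le_div_iff₀ (by positivity)]
  linarith

/-- A positive sequence whose logarithmic increments are dominated by a power of its terms
varies at most polynomially. -/
theorem abs_log_sub_log_le_of_increment_le {A β : ℝ} (hA : 0 ≤ A) (hβ : 0 < β) :
    ∃ D > 0, ∀ l : ℕ → ℝ, (∀ k, 0 < l k) → (∀ k, l k ≤ 1) →
      (∀ k, |Real.log (l (k + 1)) - Real.log (l k)| ≤ A * l k ^ β) →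
      ∀ n : ℕ, |Real.log (l n) - Real.log (l 0)| ≤ β⁻¹ * Real.log (1 + D * n) := by
  set B := β * A
  have hB : 0 ≤ B := by positivity
  refine ⟨B * Real.exp B + 1, by positivity, fun l hl0 hl1 hinc n => ?_⟩
  set D := B * Real.exp B + 1 with hD
  set a : ℕ → ℝ := fun k => l k ^ (-β) with ha
  have ha0 : ∀ k, 0 < a k := fun k => Real.rpow_pos_of_pos (hl0 k) _
  have ha1 : ∀ k, 1 ≤ a k := fun k =>
    Real.one_le_rpow_of_pos_of_le_one_of_nonpos (hl0 k) (hl1 k) (by linarith)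
  have hlog : ∀ k, Real.log (a k) = -β * Real.log (l k) := fun k => Real.log_rpow (hl0 k) _
  have hstep : ∀ k, |a (k + 1) - a k| ≤ D := by
    intro k
    set t := Real.log (a (k + 1)) - Real.log (a k) with ht
    have htb : |t| ≤ B / a k := by
      have : t = -β * (Real.log (l (k + 1)) - Real.log (l k)) := by
        rw [ht, hlog, hlog]; ring
      rw [this, abs_mul, abs_neg, abs_of_pos hβ]
      have h2 : B / a k = β * (A * l k ^ β) := by
        simp only [ha, B]
        rw [Real.rpow_neg (hl0 k).le, div_inv_eq_mul]; ring
      rw [h2]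
      exact mul_le_mul_of_nonneg_left (hinc k) hβ.le
    have hat : a k * |t| ≤ B := by
      rw [le_div_iff₀ (ha0 k)] at htb; linarith
    have htB : t ≤ B := (le_abs_self t).trans (htb.trans (div_le_self hB (ha1 k)))
    have hk : a (k + 1) = a k * Real.exp t := by
      rw [ht, Real.exp_sub, Real.exp_log (ha0 _), Real.exp_log (ha0 _)]
      field_simp [(ha0 k).ne']
    have hexp : |Real.exp t - 1| ≤ |t| * Real.exp B := by
      have hB1 : 1 ≤ Real.exp B := Real.one_le_exp hB
      have hup : Real.exp t - 1 ≤ t * Real.exp t := by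
        have h := Real.add_one_le_exp (-t)
        have h3 : Real.exp (-t) * Real.exp t = 1 := by rw [← Real.exp_add]; simp
        nlinarith [Real.exp_pos t]
      have hlow := Real.add_one_le_exp t
      have hmono : Real.exp t ≤ Real.exp B := Real.exp_le_exp.2 htB
      rw [abs_le]
      constructor
      · nlinarith [neg_abs_le t, abs_nonneg t]
      · calc Real.exp t - 1 ≤ t * Real.exp t := hup
          _ ≤ |t| * Real.exp t := by gcongr; exact le_abs_self t
          _ ≤ |t| * Real.exp B := by gcongr
    have : a (k + 1) - a k = a k * (Real.exp t - 1) := by rw [hk]; ring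
    rw [this, abs_mul, abs_of_pos (ha0 k)]
    calc a k * |Real.exp t - 1| ≤ a k * (|t| * Real.exp B) := by
          gcongr; exact (ha0 k).le
      _ = (a k * |t|) * Real.exp B := by ring
      _ ≤ B * Real.exp B := by gcongr
      _ ≤ D := by rw [hD]; linarith
  have hdist : |a n - a 0| ≤ D * n := by
    have := dist_le_range_sum_of_dist_le (f := a) n (d := fun _ => D)
      (fun {k} _ => by rw [Real.dist_eq, abs_sub_comm]; exact hstep k)
    rw [Real.dist_eq, abs_sub_comm] at this
    simpa [mul_comm] using this
  have hDpos : 0 < D := by positivity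
  have hup : ∀ x y : ℝ, 1 ≤ x → 1 ≤ y → |x - y| ≤ D * n →
      Real.log x - Real.log y ≤ Real.log (1 + D * n) := by
    intro x y hx hy hxy
    have hxy' := (abs_le.1 hxy).2
    have hDn : 0 ≤ D * n := by positivity
    rw [sub_le_iff_le_add, ← Real.log_mul (by positivity) (by positivity)]
    apply Real.log_le_log (by positivity)
    nlinarith
  have h1 := hup _ _ (ha1 n) (ha1 0) hdist
  have h2 := hup _ _ (ha1 0) (ha1 n) (by rwa [abs_sub_comm])
  rw [hlog, hlog] at h1 h2
  have : |β * (Real.log (l n) - Real.log (l 0))| ≤ Real.log (1 + D * n) := by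
    rw [abs_le]; constructor <;> linarith
  rw [abs_mul, abs_of_pos hβ] at this
  rwa [inv_mul_eq_div, le_div_iff₀ hβ, mul_comm]

/-- A Hölder derivative forces `|f' - 1|` to be controlled by a power
of the displacement `|f x - x|`, as soon as `f' = 1` at every fixed point. -/
theorem abs_deriv_sub_one_le_displacement {f F : ℝ → ℝ} {α K : ℝ} (hα0 : 0 < α) (hK : 0 < K)
    (hd : ∀ x ∈ Icc (0:ℝ) 1, HasDerivWithinAt f (F x) (Icc (0:ℝ) 1) x)
    (hF : ∀ x ∈ Icc (0:ℝ) 1, ∀ y ∈ Icc (0:ℝ) 1, |F x - F y| ≤ K * |x - y| ^ α)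
    (h0 : f 0 = 0) (h1 : f 1 = 1)
    (hfix : ∀ p ∈ Icc (0:ℝ) 1, f p = p → F p = 1) {x : ℝ} (hx : x ∈ Icc (0:ℝ) 1) :
    |F x - 1| ≤ 2 * K * (|f x - x| / K) ^ (α / (1 + α)) := by
  rcases eq_or_ne (F x) 1 with hx1 | hx1
  · rw [hx1]; simp; positivity
  have hm : 0 < |F x - 1| := abs_pos.2 (sub_ne_zero.2 hx1)
  set δ := (|F x - 1| / (2 * K)) ^ (α⁻¹) with hδ
  have hδ0 : 0 < δ := by positivity
  have hδα : |F x - 1| = 2 * K * δ ^ α := by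
    rw [hδ, Real.rpow_inv_rpow (by positivity) hα0.ne']; field_simp
  have hδα0 : 0 < δ ^ α := by positivity
  have hfar : ∀ p ∈ Icc (0:ℝ) 1, f p = p → δ < |x - p| := by
    intro p hp hfp
    by_contra! hle
    have h := hF x hx p hp
    rw [hfix p hp hfp, hδα] at h
    have : |x - p| ^ α ≤ δ ^ α := by gcongr
    nlinarith
  have hl : δ < x := by
    have := hfar 0 (by simp) h0
    rwa [sub_zero, abs_of_nonneg hx.1] at this
  have hr : δ < 1 - x := by
    have := hfar 1 (by simp) h1
    rwa [abs_sub_comm, abs_of_nonneg (sub_nonneg.2 hx.2)] at this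
  have hxl : x - δ ∈ Icc (0:ℝ) 1 := ⟨by linarith, by linarith [hx.2]⟩
  have hxr : x + δ ∈ Icc (0:ℝ) 1 := ⟨by linarith [hx.1], by linarith⟩
  suffices hu : K * δ ^ (1 + α) ≤ |f x - x| by
    rw [hδα]
    have : δ ^ α = (δ ^ (1 + α)) ^ (α / (1 + α)) := by
      rw [← Real.rpow_mul hδ0.le]; congr 1; field_simp
    rw [this]
    gcongr
    rw [le_div_iff₀ hK]; linarith
  by_contra! hlt
  rw [Real.rpow_add hδ0, Real.rpow_one] at hlt
  obtain ⟨hlt1, hlt2⟩ := abs_lt.1 hlt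
  obtain ⟨c, hc, hceq⟩ := exists_sub_eq_mul_of_hasDerivWithinAt_Icc hd hx hxr (by linarith)
  obtain ⟨d, hdm, hdeq⟩ := exists_sub_eq_mul_of_hasDerivWithinAt_Icc hd hxl hx (by linarith)
  have hnear : ∀ y ∈ Icc (0:ℝ) 1, |x - y| ≤ δ → |F x - F y| ≤ K * δ ^ α := by
    intro y hy hxy
    refine (hF x hx y hy).trans ?_
    gcongr
  have hcb := abs_le.1 <| hnear c ⟨by linarith [hc.1, hx.1], by linarith [hc.2, hxr.2]⟩
    (abs_le.2 ⟨by linarith [hc.2], by linarith [hc.1]⟩)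
  have hdb := abs_le.1 <| hnear d ⟨by linarith [hdm.1, hxl.1], by linarith [hdm.2, hx.2]⟩
    (abs_le.2 ⟨by linarith [hdm.2], by linarith [hdm.1]⟩)
  have hsub : uIcc (x - δ) (x + δ) ⊆ Icc (0:ℝ) 1 := by
    rw [uIcc_of_le (by linarith)]; exact Icc_subset_Icc hxl.1 hxr.2
  have hcont : ContinuousOn (fun z => f z - z) (uIcc (x - δ) (x + δ)) := fun z hz =>
    (((hd z (hsub hz)).continuousWithinAt).sub continuousWithinAt_id).mono hsub
  have hzero : (0:ℝ) ∈ uIcc (f (x - δ) - (x - δ)) (f (x + δ) - (x + δ)) := by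
    rcases abs_cases (F x - 1) with ⟨he, _⟩ | ⟨he, _⟩
    · have hc' : K * δ ^ α ≤ F c - 1 := by linarith
      have hd' : K * δ ^ α ≤ F d - 1 := by linarith
      exact mem_uIcc.2 (Or.inl ⟨by nlinarith, by nlinarith⟩)
    · have hc' : F c - 1 ≤ -(K * δ ^ α) := by linarith
      have hd' : F d - 1 ≤ -(K * δ ^ α) := by linarith
      exact mem_uIcc.2 (Or.inr ⟨by nlinarith, by nlinarith⟩)
  obtain ⟨p, hp, hpz⟩ := intermediate_value_uIcc hcont hzero
  have hpI := hsub hp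
  have := hfar p hpI (by simpa [sub_eq_zero] using hpz)
  rw [uIcc_of_le (by linarith)] at hp
  exact absurd (abs_le.2 ⟨by linarith [hp.2], by linarith [hp.1]⟩) this.not_ge

theorem exists_abs_sub_le_sub_eq_mul {f F : ℝ → ℝ}
    (hd : ∀ x ∈ Icc (0:ℝ) 1, HasDerivWithinAt f (F x) (Icc (0:ℝ) 1) x) {a b : ℝ}
    (ha : a ∈ Icc (0:ℝ) 1) (hb : b ∈ Icc (0:ℝ) 1) :
    ∃ c ∈ Icc (0:ℝ) 1, |a - c| ≤ |b - a| ∧ f b - f a = F c * (b - a) := by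
  rcases lt_trichotomy a b with h | rfl | h
  · obtain ⟨c, hc, he⟩ := exists_sub_eq_mul_of_hasDerivWithinAt_Icc hd ha hb h
    refine ⟨c, ⟨by linarith [ha.1, hc.1], by linarith [hc.2, hb.2]⟩, ?_, he⟩
    rw [abs_of_neg (by linarith [hc.1]), abs_of_pos (by linarith)]
    linarith [hc.2]
  · exact ⟨a, ha, by simp, by simp⟩
  · obtain ⟨c, hc, he⟩ := exists_sub_eq_mul_of_hasDerivWithinAt_Icc hd hb ha h
    refine ⟨c, ⟨by linarith [hb.1, hc.1], by linarith [hc.2, ha.2]⟩, ?_, by linarith⟩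
    rw [abs_of_pos (by linarith [hc.2]), abs_of_neg (by linarith)]
    linarith [hc.1]

/-- An orbit of an increasing map of `[0,1]` that does not start at a fixed point is strictly
monotone, so its steps are nonzero and of total length at most one. -/
theorem orbit_steps_pos_and_sum_le_one {f F : ℝ → ℝ} (hmaps : MapsTo f (Icc (0:ℝ) 1) (Icc (0:ℝ) 1))
    (hd : ∀ x ∈ Icc (0:ℝ) 1, HasDerivWithinAt f (F x) (Icc (0:ℝ) 1) x)
    (hpos : ∀ x ∈ Icc (0:ℝ) 1, 0 < F x) {x : ℝ} (hx : x ∈ Icc (0:ℝ) 1) (hfx : f x ≠ x) :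
    (∀ k, 0 < |f^[k + 1] x - f^[k] x|) ∧
      ∀ n, ∑ k ∈ Finset.range n, |f^[k + 1] x - f^[k] x| ≤ 1 := by
  have hmem : ∀ k, f^[k] x ∈ Icc (0:ℝ) 1 := fun k => hmaps.iterate k hx
  obtain ⟨s, hs, hs0⟩ : ∃ s : ℝ, |s| = 1 ∧ 0 < s * (f x - x) := by
    rcases hfx.lt_or_gt with h | h
    · exact ⟨-1, by simp, by linarith⟩
    · exact ⟨1, by simp, by linarith⟩
  have hstep : ∀ k, 0 < s * (f^[k + 1] x - f^[k] x) := by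
    intro k
    induction k with
    | zero => simpa using hs0
    | succ k ih =>
      obtain ⟨c, hc, -, he⟩ := exists_abs_sub_le_sub_eq_mul hd (hmem k) (hmem (k + 1))
      rw [← Function.iterate_succ_apply' f, ← Function.iterate_succ_apply' f] at he
      rw [he, mul_left_comm]
      exact mul_pos (hpos c hc) ih
  have habs : ∀ k, |f^[k + 1] x - f^[k] x| = s * (f^[k + 1] x - f^[k] x) := by
    intro k
    rw [← abs_of_pos (hstep k), abs_mul, hs, one_mul]
  refine ⟨fun k => habs k ▸ hstep k, fun n => ?_⟩
  simp_rw [habs]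
  rw [← Finset.mul_sum, Finset.sum_range_sub (fun k => f^[k] x)]
  calc s * (f^[n] x - f^[0] x) ≤ |s * (f^[n] x - f^[0] x)| := le_abs_self _
    _ = |f^[n] x - x| := by rw [abs_mul, hs, one_mul]; rfl
    _ ≤ 1 := abs_le.2 ⟨by linarith [(hmem n).1, hx.2], by linarith [(hmem n).2, hx.1]⟩

/-- The distortion of the iterates of a `C^{1+α}` diffeomorphism which is tangent to the identity
at its fixed points. -/
theorem exists_abs_sum_log_deriv_le {f F : ℝ → ℝ} {α K m : ℝ} (hα0 : 0 < α) (hα1 : α < 1)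
    (hK : 0 < K) (hm : 0 < m) (hm1 : m ≤ 1)
    (hmaps : MapsTo f (Icc (0:ℝ) 1) (Icc (0:ℝ) 1))
    (hd : ∀ x ∈ Icc (0:ℝ) 1, HasDerivWithinAt f (F x) (Icc (0:ℝ) 1) x)
    (hmF : ∀ x ∈ Icc (0:ℝ) 1, m ≤ F x)
    (hF : ∀ x ∈ Icc (0:ℝ) 1, ∀ y ∈ Icc (0:ℝ) 1, |F x - F y| ≤ K * |x - y| ^ α)
    (h0 : f 0 = 0) (h1 : f 1 = 1)
    (hfix : ∀ p ∈ Icc (0:ℝ) 1, f p = p → F p = 1) :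
    ∃ C > 0, ∀ x ∈ Icc (0:ℝ) 1, ∀ n : ℕ, 1 ≤ n →
      |∑ k ∈ Finset.range n, Real.log (F (f^[k] x))| ≤ C * (n:ℝ) ^ (1 - α) := by
  set β := α / (1 + α) with hβdef
  have hβ : 0 < β := by positivity
  have hβα : β ≤ α := div_le_self hα0.le (by linarith)
  set A := 2 * K * K⁻¹ ^ β / m + K / m with hAdef
  have hA : 0 ≤ A := by positivity
  obtain ⟨D, hD, hseq⟩ := abs_log_sub_log_le_of_increment_le hA hβ
  have hα' : 0 < 1 - α := by linarith
  refine ⟨K / m + β⁻¹ * ((1 + D) ^ (1 - α) / (1 - α)), by positivity, fun x hx n hn => ?_⟩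
  have hmem : ∀ k, f^[k] x ∈ Icc (0:ℝ) 1 := fun k => hmaps.iterate k hx
  by_cases hfx : f x = x
  · have : ∀ k, F (f^[k] x) = 1 := fun k => by
      rw [Function.iterate_fixed hfx]; exact hfix x hx hfx
    simp only [this, Real.log_one, Finset.sum_const_zero, abs_zero]
    positivity
  obtain ⟨hl0, hlsum⟩ := orbit_steps_pos_and_sum_le_one hmaps hd
    (fun y hy => hm.trans_le (hmF y hy)) hx hfx
  set l : ℕ → ℝ := fun k => |f^[k + 1] x - f^[k] x| with hl
  have hl1 : ∀ k, l k ≤ 1 := fun k => abs_le.2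
    ⟨by linarith [(hmem (k + 1)).1, (hmem k).2], by linarith [(hmem (k + 1)).2, (hmem k).1]⟩
  have hratio : ∀ k, |Real.log (F (f^[k] x)) - (Real.log (l (k + 1)) - Real.log (l k))|
      ≤ K / m * l k ^ α := by
    intro k
    obtain ⟨c, hc, hcd, he⟩ := exists_abs_sub_le_sub_eq_mul hd (hmem k) (hmem (k + 1))
    rw [← Function.iterate_succ_apply' f, ← Function.iterate_succ_apply' f] at he
    have hFc := hm.trans_le (hmF c hc)
    have hle : l (k + 1) = F c * l k := by
      simp only [hl]; rw [he, abs_mul, abs_of_pos hFc]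
    rw [hle, Real.log_mul hFc.ne' (hl0 k).ne', add_sub_cancel_right]
    calc _ ≤ |F (f^[k] x) - F c| / m := abs_log_sub_log_le hm (hmF _ (hmem k)) (hmF c hc)
      _ ≤ (K * |f^[k] x - c| ^ α) / m := by gcongr; exact hF _ (hmem k) c hc
      _ ≤ (K * l k ^ α) / m := by gcongr
      _ = K / m * l k ^ α := by ring
  have hlogF : ∀ k, |Real.log (F (f^[k] x))| ≤ 2 * K * K⁻¹ ^ β / m * l k ^ β := by
    intro k
    have h := abs_log_sub_log_le hm (hmF _ (hmem k)) hm1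
    rw [Real.log_one, sub_zero] at h
    have h2 := abs_deriv_sub_one_le_displacement hα0 hK hd hF h0 h1 hfix (hmem k)
    rw [← Function.iterate_succ_apply' f] at h2
    calc _ ≤ |F (f^[k] x) - 1| / m := h
      _ ≤ (2 * K * (l k / K) ^ β) / m := by gcongr
      _ = 2 * K * K⁻¹ ^ β / m * l k ^ β := by
        rw [div_eq_mul_inv (l k), Real.mul_rpow (hl0 k).le (by positivity)]; ring
  have hinc : ∀ k, |Real.log (l (k + 1)) - Real.log (l k)| ≤ A * l k ^ β := by
    intro k
    have hαβ : l k ^ α ≤ l k ^ β :=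
      Real.rpow_le_rpow_of_exponent_ge (hl0 k) (hl1 k) hβα
    have h2 : K / m * l k ^ α ≤ K / m * l k ^ β := by gcongr
    rw [hAdef, add_mul]
    have h3 := abs_le.1 (hratio k)
    have h4 := abs_le.1 (hlogF k)
    rw [abs_le]
    constructor <;> linarith [h3.1, h3.2, h4.1, h4.2]
  have hlog := hseq l hl0 hl1 hinc n
  have hn1 : (1:ℝ) ≤ n := by exact_mod_cast hn
  have hpoly : Real.log (1 + D * n) ≤ (1 + D) ^ (1 - α) / (1 - α) * (n:ℝ) ^ (1 - α) := by
    calc Real.log (1 + D * n) ≤ (1 + D * n) ^ (1 - α) / (1 - α) :=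
          Real.log_le_rpow_div (by positivity) hα'
      _ ≤ ((1 + D) * n) ^ (1 - α) / (1 - α) := by gcongr; linarith
      _ = _ := by rw [Real.mul_rpow (by positivity) (by positivity)]; ring
  have hdiff : |∑ k ∈ Finset.range n, Real.log (F (f^[k] x)) - (Real.log (l n) - Real.log (l 0))|
      ≤ K / m * (n:ℝ) ^ (1 - α) := by
    rw [← Finset.sum_range_sub (fun k => Real.log (l k)), ← Finset.sum_sub_distrib]
    calc _ ≤ ∑ k ∈ Finset.range n, K / m * l k ^ α :=
          (Finset.abs_sum_le_sum_abs _ _).trans (Finset.sum_le_sum fun k _ => hratio k)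
      _ = K / m * ∑ k ∈ Finset.range n, l k ^ α := by rw [Finset.mul_sum]
      _ ≤ _ := by
        gcongr
        exact sum_rpow_le_rpow_of_sum_le_one hα0 hα1 (fun k => (hl0 k).le) hn (hlsum n)
  have hpoly' := mul_le_mul_of_nonneg_left hpoly (inv_nonneg.2 hβ.le)
  have h3 := abs_le.1 hdiff
  have h4 := abs_le.1 (hlog.trans hpoly')
  rw [add_mul, abs_le]
  constructor <;> linarith [h3.1, h3.2, h4.1, h4.2]

theorem bddAbove_abs_derivWithin_iterate {f F : ℝ → ℝ}
    (hmaps : MapsTo f (Icc (0:ℝ) 1) (Icc (0:ℝ) 1))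
    (hd : ∀ x ∈ Icc (0:ℝ) 1, HasDerivWithinAt f (F x) (Icc (0:ℝ) 1) x)
    (hc : ContinuousOn F (Icc (0:ℝ) 1)) (n : ℕ) :
    BddAbove ((fun x => |derivWithin f^[n] (Icc (0:ℝ) 1) x|) '' Icc (0:ℝ) 1) := by
  obtain ⟨M, hM⟩ := isCompact_Icc.exists_bound_of_continuousOn hc
  refine ⟨M ^ n, ?_⟩
  rintro _ ⟨x, hx, rfl⟩
  simp only
  rw [(hasDerivWithinAt_iterate_prod hmaps hd n hx).derivWithin
    (uniqueDiffOn_Icc zero_lt_one x hx), Finset.abs_prod]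
  calc _ ≤ ∏ _k ∈ Finset.range n, M :=
        Finset.prod_le_prod (fun _ _ => abs_nonneg _) fun k _ => hM _ (hmaps.iterate k hx)
    _ = M ^ n := by simp

/-- If the suprema of `|(fⁿ)'|` grow subexponentially, then `f' ≤ 1` at the fixed points. -/
theorem deriv_le_one_of_fixed {f F : ℝ → ℝ} {Γ : ℕ → ℝ}
    (hmaps : MapsTo f (Icc (0:ℝ) 1) (Icc (0:ℝ) 1))
    (hd : ∀ x ∈ Icc (0:ℝ) 1, HasDerivWithinAt f (F x) (Icc (0:ℝ) 1) x)
    (hc : ContinuousOn F (Icc (0:ℝ) 1)) (hle : ∀ n, supAbsDeriv f^[n] ≤ Γ n)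
    (hΓ : Tendsto (fun n : ℕ => Γ n ^ (1 / (n:ℝ))) atTop (nhds 1))
    {p : ℝ} (hp : p ∈ Icc (0:ℝ) 1) (hfp : f p = p) (hFp : 0 < F p) : F p ≤ 1 := by
  refine ge_of_tendsto hΓ ?_
  filter_upwards [eventually_ge_atTop 1] with n hn
  have h1 : F p ^ n ≤ Γ n := by
    refine le_trans ?_ ((le_csSup (bddAbove_abs_derivWithin_iterate hmaps hd hc n)
      (mem_image_of_mem _ hp)).trans (hle n))
    rw [(hasDerivWithinAt_iterate_prod hmaps hd n hp).derivWithin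
      (uniqueDiffOn_Icc zero_lt_one p hp)]
    simp only [Function.iterate_fixed hfp, Finset.prod_const, Finset.card_range]
    exact le_abs_self _
  calc F p = (F p ^ n) ^ (1 / (n:ℝ)) := by
        rw [one_div, Real.pow_rpow_inv_natCast hFp.le (by omega)]
    _ ≤ Γ n ^ (1 / (n:ℝ)) := by gcongr

/-- **Theorem 3 (Borichev).** If `f ∈ H_α[0,1]` (Hölder class, `0 < α < 1`) and `γ(f) = 1`,
then `log Γ_n(f) ≤ C(f,α) · n^(1-α)` for all `n ∈ ℕ`. -/
theorem growth_gap_Holder (α : ℝ) (hα0 : 0 < α) (hα1 : α < 1)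
    (f g : ℝ → ℝ) (hf : IsDiff01 f g)
    (hHolder : ∃ C > 0, ∀ x ∈ Set.Icc (0:ℝ) 1, ∀ y ∈ Set.Icc (0:ℝ) 1,
      |derivWithin f (Set.Icc (0:ℝ) 1) x - derivWithin f (Set.Icc (0:ℝ) 1) y|
        ≤ C * |x - y| ^ α)
    (hγ : GammaEqOne f g) :
    ∃ C > 0, ∀ n : ℕ, 1 ≤ n → Real.log (Gamma f g n) ≤ C * (n:ℝ) ^ (1 - α) := by
  obtain ⟨K, hK, hH⟩ := hHolder
  set I := Icc (0:ℝ) 1 with hI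
  set F := derivWithin f I with hFdef
  set G := derivWithin g I with hGdef
  have hu : UniqueDiffOn ℝ I := uniqueDiffOn_Icc zero_lt_one
  have hdf : ∀ x ∈ I, HasDerivWithinAt f (F x) I x := fun x hx =>
    (hf.contDiffOn.differentiableOn one_ne_zero x hx).hasDerivWithinAt
  have hdg : ∀ x ∈ I, HasDerivWithinAt g (G x) I x := fun x hx =>
    (hf.inv_contDiffOn.differentiableOn one_ne_zero x hx).hasDerivWithinAt
  have hcF : ContinuousOn F I := hf.contDiffOn.continuousOn_derivWithin hu le_rfl
  have hcG : ContinuousOn G I := hf.inv_contDiffOn.continuousOn_derivWithin hu le_rfl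
  have hfix : ∀ p ∈ I, f p = p → F p = 1 := by
    intro p hp hfp
    have hgp : g p = p := by simpa [hfp] using hf.left_inv p hp
    have hFp := hf.deriv_pos p hp
    have hprod : F p * G p = 1 :=
      mul_eq_one_of_hasDerivWithinAt_inverse hp hf.inv_mapsTo (by rw [hgp]; exact hdf p hp)
        (hdg p hp) hf.right_inv
    have hGp : 0 < G p := by
      by_contra! h
      nlinarith
    have h1 : F p ≤ 1 := deriv_le_one_of_fixed hf.mapsTo hdf hcF
      (fun n => le_max_left _ _) hγ hp hfp hFp
    have h2 : G p ≤ 1 := deriv_le_one_of_fixed hf.inv_mapsTo hdg hcG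
      (fun n => le_max_right _ _) hγ hp hgp hGp
    nlinarith
  obtain ⟨q, hq, hqmin⟩ := isCompact_Icc.exists_isMinOn (nonempty_Icc.2 zero_le_one) hcF
  obtain ⟨C, hC, hdist⟩ := exists_abs_sum_log_deriv_le hα0 hα1 hK (hf.deriv_pos q hq)
    ((hqmin (left_mem_Icc.2 zero_le_one)).trans_eq
      (hfix 0 (left_mem_Icc.2 zero_le_one) hf.map_zero))
    hf.mapsTo hdf (fun x hx => hqmin hx) hH hf.map_zero hf.map_one hfix
  refine ⟨C, hC, fun n hn => ?_⟩
  have hE : 0 ≤ C * (n:ℝ) ^ (1 - α) := by positivity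
  set P : ℝ → ℝ := fun x => ∏ k ∈ Finset.range n, F (f^[k] x) with hP
  have hPpos : ∀ x ∈ I, 0 < P x := fun x hx =>
    Finset.prod_pos fun k _ => hf.deriv_pos _ (hf.mapsTo.iterate k hx)
  have hPlog : ∀ x ∈ I, |Real.log (P x)| ≤ C * (n:ℝ) ^ (1 - α) := by
    intro x hx
    rw [hP, Real.log_prod fun k _ => (hf.deriv_pos _ (hf.mapsTo.iterate k hx)).ne']
    exact hdist x hx n hn
  have hdfn : ∀ x ∈ I, HasDerivWithinAt f^[n] (P x) I x := fun x hx =>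
    hasDerivWithinAt_iterate_prod hf.mapsTo hdf n hx
  have hinv : ∀ j : ℕ, ∀ z ∈ I, f^[j] (g^[j] z) = z := by
    intro j
    induction j with
    | zero => intro z _; rfl
    | succ j ih =>
      intro z hz
      rw [Function.iterate_succ_apply' g, Function.iterate_succ_apply f,
        hf.right_inv _ (hf.inv_mapsTo.iterate j hz)]
      exact ih z hz
  have hΓ : Gamma f g n ≤ Real.exp (C * (n:ℝ) ^ (1 - α)) := by
    refine max_le ?_ ?_ <;>
      refine csSup_le ((nonempty_Icc.2 zero_le_one).image _) ?_ <;>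
      rintro _ ⟨x, hx, rfl⟩ <;> simp only
    · rw [(hdfn x hx).derivWithin (hu x hx), abs_of_pos (hPpos x hx),
        ← Real.log_le_iff_le_exp (hPpos x hx)]
      exact (abs_le.1 (hPlog x hx)).2
    · have hgx := hf.inv_mapsTo.iterate n hx
      have hdgn := hasDerivWithinAt_iterate_prod hf.inv_mapsTo hdg n hx
      have hmul := mul_eq_one_of_hasDerivWithinAt_inverse hx (hf.inv_mapsTo.iterate n)
        (hdfn _ hgx) hdgn (hinv n)
      rw [hdgn.derivWithin (hu x hx), eq_inv_of_mul_eq_one_right hmul,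
        abs_of_pos (inv_pos.2 (hPpos _ hgx)), ← Real.log_le_iff_le_exp (inv_pos.2 (hPpos _ hgx)),
        Real.log_inv]
      linarith [(abs_le.1 (hPlog _ hgx)).1]
  have hΓ0 : 0 ≤ Gamma f g n := le_max_of_le_left <|
    Real.sSup_nonneg (by rintro _ ⟨x, -, rfl⟩; exact abs_nonneg _)
  rcases hΓ0.eq_or_lt with h | h
  · rw [← h, Real.log_zero]; exact hE
  · exact (Real.log_le_iff_le_exp h).2 hΓ
end

section
/- Let ω : [0,1] → [0,∞) be a strictly increasing modulus of continuity with lim_{x→0⁺} ω(x)/(x·log(e/x)) = 0, and let ω^{-1} denote its inverse function. Then for every f ∈ Diff₀^ω[0,1] with γ(f) = 1 and every ε > 0 there exists N such that for all n ≥ N one has log Γ_n(f) ≤ (1+ε) · log( n / ω^{-1}(2/n) ). -/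
open Set Filter

theorem IsModCont.map_nat_mul_le {ω : ℝ → ℝ} (hω : IsModCont ω) {x : ℝ} (hx : 0 ≤ x) (k : ℕ)
    (hk : k * x ≤ 1) : ω (k * x) ≤ k * ω x := by
  induction k with
  | zero => simp [hω.map_zero]
  | succ k ih =>
    push_cast at hk ⊢
    have hle : k * x ≤ 1 := by nlinarith
    have h := hω.subadd (k * x) x (by positivity) hx (by linarith)
    rw [add_mul, one_mul]
    linarith [ih hle]

/-- A modulus of continuity dominates a linear function. -/
theorem IsModCont.linear_le {ω : ℝ → ℝ} (hω : IsModCont ω) {x : ℝ} (hx : x ∈ Ioc (0:ℝ) 1) :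
    ω 1 * x ≤ 2 * ω x := by
  obtain ⟨hx0, hx1⟩ := hx
  set k := ⌊1 / x⌋₊ with hk
  have hkx : k * x ≤ 1 := by
    have := Nat.floor_le (a := 1 / x) (by positivity)
    rwa [le_div_iff₀ hx0] at this
  have hkx' : 1 < (k + 1) * x := by
    have := Nat.lt_floor_add_one (1 / x)
    rwa [div_lt_iff₀ hx0] at this
  have h1 := hω.map_nat_mul_le hx0.le k hkx
  have h2 := hω.subadd (k * x) (1 - k * x) (by positivity) (by linarith) (by linarith)
  have h3 : ω (1 - k * x) ≤ ω x :=
    hω.monotoneOn ⟨by linarith, by nlinarith [mul_nonneg (Nat.cast_nonneg (α := ℝ) k) hx0.le]⟩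
      ⟨hx0.le, hx1⟩ (by linarith)
  have h4 : 0 ≤ ω x := hω.nonneg x ⟨hx0.le, hx1⟩
  have h5 : ω 1 ≤ (k + 1) * ω x := by
    have : k * x + (1 - k * x) = 1 := by ring
    rw [this] at h2
    linarith
  calc ω 1 * x ≤ (k + 1) * ω x * x := by gcongr
    _ = (k * x + x) * ω x := by ring
    _ ≤ 2 * ω x := by gcongr; linarith

theorem IsModCont.le_mul_log {ω : ℝ → ℝ} (hω : IsModCont ω)
    (hlim : Tendsto (fun x => ω x / (x * Real.log (Real.exp 1 / x))) (nhdsWithin 0 (Ioi 0))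
      (nhds 0)) {η : ℝ} (hη : 0 < η) :
    ∃ K, 0 ≤ K ∧ ∀ x ∈ Ioc (0:ℝ) 1, ω x ≤ x * (η * (1 - Real.log x) + K) := by
  have hev := hlim.eventually (gt_mem_nhds hη)
  rw [eventually_nhdsWithin_iff, Metric.eventually_nhds_iff] at hev
  obtain ⟨δ, hδ, hsmall⟩ := hev
  have hω1 : 0 ≤ ω 1 := hω.nonneg 1 (by simp)
  refine ⟨ω 1 / δ, by positivity, fun x ⟨hx0, hx1⟩ => ?_⟩
  have hlog : Real.log x ≤ 0 := Real.log_nonpos hx0.le hx1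
  have hK : 0 ≤ ω 1 / δ := by positivity
  rcases lt_or_ge x δ with hxδ | hxδ
  · have h := hsmall (y := x) (by simpa [abs_of_pos hx0] using hxδ) hx0
    rw [Real.log_div (Real.exp_pos 1).ne' hx0.ne', Real.log_exp,
      div_lt_iff₀ (mul_pos hx0 (by linarith))] at h
    nlinarith
  · have h1 : ω x ≤ ω 1 := hω.monotoneOn ⟨hx0.le, hx1⟩ (by simp) hx1
    have h2 : ω 1 ≤ x * (ω 1 / δ) := by
      rw [mul_div_assoc', le_div_iff₀ hδ]
      nlinarith
    have h3 : 0 ≤ x * (η * (1 - Real.log x)) := by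
      apply mul_nonneg hx0.le (mul_nonneg hη.le (by linarith))
    linarith

section Iterate

variable {F : ℝ → ℝ} {s : Set ℝ}

theorem hasDerivWithinAt_iterate (hmaps : MapsTo F s s) (hF : DifferentiableOn ℝ F s) (n : ℕ)
    {x : ℝ} (hx : x ∈ s) :
    HasDerivWithinAt F^[n] (∏ k ∈ Finset.range n, derivWithin F s (F^[k] x)) s x := by
  induction n with
  | zero => simpa using hasDerivWithinAt_id x s
  | succ n ih =>
    rw [Finset.prod_range_succ, mul_comm, Function.iterate_succ']
    exact (hF _ (hmaps.iterate n hx)).hasDerivWithinAt.comp x ih (hmaps.iterate n)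

theorem derivWithin_iterate (hs : UniqueDiffOn ℝ s) (hmaps : MapsTo F s s)
    (hF : DifferentiableOn ℝ F s) (n : ℕ) {x : ℝ} (hx : x ∈ s) :
    derivWithin F^[n] s x = ∏ k ∈ Finset.range n, derivWithin F s (F^[k] x) :=
  (hasDerivWithinAt_iterate hmaps hF n hx).derivWithin (hs x hx)

end Iterate

theorem abs_derivWithin_iterate_le_supAbsDeriv {F : ℝ → ℝ}
    (hmaps : MapsTo F (Icc (0:ℝ) 1) (Icc (0:ℝ) 1)) (hF : ContDiffOn ℝ 1 F (Icc (0:ℝ) 1)) (n : ℕ)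
    {x : ℝ} (hx : x ∈ Icc (0:ℝ) 1) :
    |derivWithin F^[n] (Icc (0:ℝ) 1) x| ≤ supAbsDeriv F^[n] := by
  have hu : UniqueDiffOn ℝ (Icc (0:ℝ) 1) := uniqueDiffOn_Icc one_pos
  obtain ⟨M, hM⟩ := isCompact_Icc.exists_bound_of_continuousOn
    (hF.continuousOn_derivWithin hu le_rfl)
  refine le_csSup ⟨M ^ n, ?_⟩ (mem_image_of_mem _ hx)
  rintro _ ⟨y, hy, rfl⟩
  simp only [derivWithin_iterate hu hmaps (hF.differentiableOn one_ne_zero) n hy, Finset.abs_prod]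
  calc _ ≤ ∏ _k ∈ Finset.range n, M := Finset.prod_le_prod (fun _ _ => abs_nonneg _)
        fun k _ => hM _ (hmaps.iterate k hy)
    _ = M ^ n := by simp

namespace IsDiff01

variable {f g : ℝ → ℝ}

theorem differentiableOn (hf : IsDiff01 f g) : DifferentiableOn ℝ f (Icc (0:ℝ) 1) :=
  hf.contDiffOn.differentiableOn one_ne_zero

theorem inv_differentiableOn (hf : IsDiff01 f g) : DifferentiableOn ℝ g (Icc (0:ℝ) 1) :=
  hf.inv_contDiffOn.differentiableOn one_ne_zero

theorem iterate_right_inv (hf : IsDiff01 f g) (n : ℕ) {y : ℝ} (hy : y ∈ Icc (0:ℝ) 1) :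
    f^[n] (g^[n] y) = y := by
  induction n generalizing y with
  | zero => rfl
  | succ n ih =>
    rw [Function.iterate_succ_apply' g, Function.iterate_succ_apply f,
      hf.right_inv _ (hf.inv_mapsTo.iterate n hy), ih hy]

theorem derivWithin_inv_iterate (hf : IsDiff01 f g) (n : ℕ) {y : ℝ} (hy : y ∈ Icc (0:ℝ) 1) :
    derivWithin g^[n] (Icc (0:ℝ) 1) y =
      (∏ k ∈ Finset.range n, derivWithin f (Icc (0:ℝ) 1) (f^[k] (g^[n] y)))⁻¹ := by
  have hu : UniqueDiffOn ℝ (Icc (0:ℝ) 1) := uniqueDiffOn_Icc one_pos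
  have h1 := hasDerivWithinAt_iterate hf.inv_mapsTo hf.inv_differentiableOn n hy
  have h2 := hasDerivWithinAt_iterate hf.mapsTo hf.differentiableOn n
    (hf.inv_mapsTo.iterate n hy)
  have h3 := h2.comp y h1 (hf.inv_mapsTo.iterate n)
  have h4 : HasDerivWithinAt (f^[n] ∘ g^[n]) 1 (Icc (0:ℝ) 1) y :=
    (hasDerivWithinAt_id y _).congr (fun z hz => hf.iterate_right_inv n hz)
      (hf.iterate_right_inv n hy)
  rw [h1.derivWithin (hu y hy)]
  exact eq_inv_of_mul_eq_one_right ((hu y hy).eq_deriv _ h3 h4)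

/-- If `γ(f) = 1`, then `f` has derivative one at each of its fixed points. -/
theorem derivWithin_eq_one_of_fixed (hf : IsDiff01 f g) (hγ : GammaEqOne f g) {p : ℝ}
    (hp : p ∈ Icc (0:ℝ) 1) (hfp : f p = p) : derivWithin f (Icc (0:ℝ) 1) p = 1 := by
  have hu : UniqueDiffOn ℝ (Icc (0:ℝ) 1) := uniqueDiffOn_Icc one_pos
  set a := derivWithin f (Icc (0:ℝ) 1) p with ha
  have ha0 : 0 < a := hf.deriv_pos p hp
  have hgp : g p = p := by
    have := hf.left_inv p hp
    rwa [hfp] at this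
  have key : ∀ b : ℝ, 0 ≤ b → (∀ n, b ^ n ≤ Gamma f g n) → b ≤ 1 := by
    intro b hb h
    refine ge_of_tendsto hγ ?_
    filter_upwards [eventually_ge_atTop 1] with n hn
    calc b = (b ^ n) ^ (1 / (n:ℝ)) := by
          rw [one_div, Real.pow_rpow_inv_natCast hb (by omega)]
      _ ≤ _ := Real.rpow_le_rpow (by positivity) (h n) (by positivity)
  have hfk : ∀ k, f^[k] p = p := fun k => Function.iterate_fixed hfp k
  have hgk : ∀ k, g^[k] p = p := fun k => Function.iterate_fixed hgp k
  have h1 : a ≤ 1 := by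
    refine key a ha0.le fun n => le_max_of_le_left ?_
    refine le_trans (le_of_eq ?_)
      (abs_derivWithin_iterate_le_supAbsDeriv hf.mapsTo hf.contDiffOn n hp)
    rw [derivWithin_iterate hu hf.mapsTo hf.differentiableOn n hp]
    simp [hfk, ← ha, abs_of_pos ha0]
  have h2 : a⁻¹ ≤ 1 := by
    refine key a⁻¹ (by positivity) fun n => le_max_of_le_right ?_
    refine le_trans (le_of_eq ?_)
      (abs_derivWithin_iterate_le_supAbsDeriv hf.inv_mapsTo hf.inv_contDiffOn n hp)
    rw [hf.derivWithin_inv_iterate n hp]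
    simp [hgk, hfk, ← ha, abs_of_pos ha0]
  exact le_antisymm h1 ((inv_le_one₀ ha0).1 h2)

theorem exists_sub_eq_derivWithin_mul (hf : IsDiff01 f g) {x y : ℝ} (hx : x ∈ Icc (0:ℝ) 1)
    (hy : y ∈ Icc (0:ℝ) 1) : ∃ z ∈ Icc (0:ℝ) 1, |x - z| ≤ |y - x| ∧
      f y - f x = derivWithin f (Icc (0:ℝ) 1) z * (y - x) := by
  have main : ∀ a ∈ Icc (0:ℝ) 1, ∀ b ∈ Icc (0:ℝ) 1, a < b →
      ∃ z ∈ Ioo a b, f b - f a = derivWithin f (Icc (0:ℝ) 1) z * (b - a) := by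
    intro a ha b hb hab
    obtain ⟨z, hz, h⟩ := exists_hasDerivAt_eq_slope f (derivWithin f (Icc (0:ℝ) 1)) hab
      (hf.contDiffOn.continuousOn.mono (Icc_subset_Icc ha.1 hb.2)) fun z hz =>
        (hf.differentiableOn z ⟨by linarith [ha.1, hz.1], by linarith [hb.2, hz.2]⟩
          ).hasDerivWithinAt.hasDerivAt
          (Icc_mem_nhds (by linarith [ha.1, hz.1]) (by linarith [hb.2, hz.2]))
    refine ⟨z, hz, ?_⟩
    rw [h, div_mul_cancel₀ _ (by linarith)]
  rcases lt_trichotomy x y with h | h | h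
  · obtain ⟨z, hz, e⟩ := main x hx y hy h
    refine ⟨z, ⟨by linarith [hx.1, hz.1], by linarith [hy.2, hz.2]⟩, ?_, e⟩
    rw [abs_of_pos (sub_pos.2 h), abs_of_neg (by linarith [hz.1])]
    linarith [hz.2]
  · exact ⟨x, hx, by simp, by simp [h]⟩
  · obtain ⟨z, hz, e⟩ := main y hy x hx h
    refine ⟨z, ⟨by linarith [hy.1, hz.1], by linarith [hx.2, hz.2]⟩, ?_, by linarith⟩
    rw [abs_of_neg (sub_neg.2 h), abs_of_pos (by linarith [hz.2])]
    linarith [hz.1]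

theorem strictMonoOn (hf : IsDiff01 f g) : StrictMonoOn f (Icc (0:ℝ) 1) := by
  intro x hx y hy hxy
  obtain ⟨z, hz, -, h⟩ := hf.exists_sub_eq_derivWithin_mul hx hy
  have := mul_pos (hf.deriv_pos z hz) (sub_pos.2 hxy)
  linarith

/-- The steps along an orbit all go in the same direction. -/
theorem sum_abs_step_le_one (hf : IsDiff01 f g) {x : ℝ} (hx : x ∈ Icc (0:ℝ) 1) (n : ℕ) :
    ∑ k ∈ Finset.range n, |f^[k + 1] x - f^[k] x| ≤ 1 := by
  have hmem : ∀ k, f^[k] x ∈ Icc (0:ℝ) 1 := fun k => hf.mapsTo.iterate k hx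
  have htel : ∑ k ∈ Finset.range n, (f^[k + 1] x - f^[k] x) = f^[n] x - x :=
    Finset.sum_range_sub (fun k => f^[k] x) n
  have hn := hmem n
  rcases le_total x (f x) with h | h
  · have hstep : ∀ k, f^[k] x ≤ f^[k + 1] x := by
      intro k
      induction k with
      | zero => simpa using h
      | succ k ih =>
        rw [Function.iterate_succ_apply' f k, Function.iterate_succ_apply' f (k + 1)]
        exact hf.strictMonoOn.monotoneOn (hmem _) (hmem _) ih
    rw [Finset.sum_congr rfl fun k _ => abs_of_nonneg (sub_nonneg.2 (hstep k)), htel]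
    linarith [hn.2, hx.1]
  · have hstep : ∀ k, f^[k + 1] x ≤ f^[k] x := by
      intro k
      induction k with
      | zero => simpa using h
      | succ k ih =>
        rw [Function.iterate_succ_apply' f k, Function.iterate_succ_apply' f (k + 1)]
        exact hf.strictMonoOn.monotoneOn (hmem _) (hmem _) ih
    rw [Finset.sum_congr rfl fun k _ => abs_of_nonpos (sub_nonpos.2 (hstep k)),
      Finset.sum_neg_distrib, htel]
    linarith [hn.1, hx.2]

end IsDiff01

/-- A function with slowly varying derivative, whose derivative vanishes at its zeros, cannot be
increasing fast at a point where it is small. -/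
theorem deriv_le_of_small {u u' : ℝ → ℝ} {h s : ℝ} (hh : 0 < h) (hs : 0 < s)
    (hu : ∀ x ∈ Icc (0:ℝ) 1, HasDerivWithinAt u (u' x) (Icc (0:ℝ) 1) x)
    (hosc : ∀ x ∈ Icc (0:ℝ) 1, ∀ y ∈ Icc (0:ℝ) 1, |x - y| ≤ h → |u' x - u' y| ≤ s / 2)
    (hzero : ∀ x ∈ Icc (0:ℝ) 1, u x = 0 → u' x = 0) (h0 : u 0 = 0) (h1 : u 1 = 0)
    {x : ℝ} (hx : x ∈ Icc (0:ℝ) 1) (hux : |u x| < h * s / 2) : u' x ≤ s := by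
  by_contra! hlt
  have hbig : ∀ y ∈ Icc (0:ℝ) 1, |x - y| ≤ h → s / 2 < u' y := by
    intro y hy hxy
    have := (abs_le.1 (hosc x hx y hy hxy)).2
    linarith
  have hleft : h < x := by
    by_contra! hc
    have h0' : (0:ℝ) ∈ Icc (0:ℝ) 1 := by simp
    have := hbig 0 h0' (by rwa [sub_zero, abs_of_nonneg hx.1])
    rw [hzero 0 h0' h0] at this
    linarith
  have hright : x + h < 1 := by
    by_contra! hc
    have h1' : (1:ℝ) ∈ Icc (0:ℝ) 1 := by simp
    have := hbig 1 h1' (by rw [abs_of_nonpos (by linarith [hx.2])]; linarith)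
    rw [hzero 1 h1' h1] at this
    linarith
  have hsub : Icc (x - h) (x + h) ⊆ Icc (0:ℝ) 1 := Icc_subset_Icc (by linarith) (by linarith)
  have hcont : ContinuousOn u (Icc (x - h) (x + h)) :=
    fun y hy => ((hu y (hsub hy)).continuousWithinAt).mono hsub
  have hslope : ∀ a b, x - h ≤ a → a < b → b ≤ x + h → s / 2 * (b - a) < u b - u a := by
    intro a b ha hab hb
    have hsub' : Icc a b ⊆ Icc (x - h) (x + h) := Icc_subset_Icc ha hb
    obtain ⟨z, hz, e⟩ := exists_hasDerivAt_eq_slope u u' hab (hcont.mono hsub') fun z hz =>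
      (hu z (hsub (hsub' ⟨hz.1.le, hz.2.le⟩))).hasDerivAt
        (Icc_mem_nhds (by linarith [hz.1]) (by linarith [hz.2]))
    have hz' := hbig z (hsub (hsub' ⟨hz.1.le, hz.2.le⟩))
      (abs_le.2 ⟨by linarith [hz.2], by linarith [hz.1]⟩)
    rwa [e, lt_div_iff₀ (by linarith)] at hz'
  have hl := hslope (x - h) x le_rfl (by linarith) (by linarith)
  have hr := hslope x (x + h) (by linarith) (by linarith) le_rfl
  obtain ⟨hu1, hu2⟩ := abs_lt.1 hux
  obtain ⟨z, hz, hz0⟩ := intermediate_value_Icc (by linarith : x - h ≤ x + h) hcont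
    (show (0:ℝ) ∈ Icc _ _ from ⟨by linarith, by linarith⟩)
  have := hbig z (hsub hz) (abs_le.2 ⟨by linarith [hz.2], by linarith [hz.1]⟩)
  rw [hzero z (hsub hz) hz0] at this
  linarith

theorem abs_deriv_le_of_small {u u' : ℝ → ℝ} {h s : ℝ} (hh : 0 < h) (hs : 0 < s)
    (hu : ∀ x ∈ Icc (0:ℝ) 1, HasDerivWithinAt u (u' x) (Icc (0:ℝ) 1) x)
    (hosc : ∀ x ∈ Icc (0:ℝ) 1, ∀ y ∈ Icc (0:ℝ) 1, |x - y| ≤ h → |u' x - u' y| ≤ s / 2)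
    (hzero : ∀ x ∈ Icc (0:ℝ) 1, u x = 0 → u' x = 0) (h0 : u 0 = 0) (h1 : u 1 = 0)
    {x : ℝ} (hx : x ∈ Icc (0:ℝ) 1) (hux : |u x| < h * s / 2) : |u' x| ≤ s := by
  refine abs_le'.2 ⟨deriv_le_of_small hh hs hu hosc hzero h0 h1 hx hux, ?_⟩
  refine deriv_le_of_small (u := fun y => -u y) (u' := fun y => -u' y) hh hs
    (fun y hy => (hu y hy).neg) (fun y hy z hz hyz => ?_) (fun y hy h => ?_) (by simpa using h0)
    (by simpa using h1) hx (by simpa using hux)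
  · rw [neg_sub_neg, abs_sub_comm]
    exact hosc y hy z hz hyz
  · simpa using hzero y hy (by simpa using h)

/-- If the increments `a k` are close to those of `log (d k)`, and are small while `d` is
below the threshold `τ`, then the partial sums of `a` are essentially at most `log (1 / τ)`. -/
theorem abs_sum_le_of_threshold {a d e : ℕ → ℝ} {c τ : ℝ} (hτ : 0 < τ) (hτ1 : τ ≤ 1)
    (hc : 0 ≤ c) (hd : ∀ k, 0 < d k) (hd1 : ∀ k, d k ≤ 1) (he : ∀ k, 0 ≤ e k)
    (hade : ∀ k, |a k - (Real.log (d (k + 1)) - Real.log (d k))| ≤ e k)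
    (hsmall : ∀ k, d k < τ ∨ d (k + 1) < τ → |a k| ≤ c) (n : ℕ) :
    |∑ k ∈ Finset.range n, a k| ≤ n * c + ∑ k ∈ Finset.range n, e k - Real.log τ := by
  have hτlog : Real.log τ ≤ 0 := Real.log_nonpos hτ.le hτ1
  have hdlog : ∀ k, Real.log (d k) ≤ 0 := fun k => Real.log_nonpos (hd k).le (hd1 k)
  have hupper : ∀ n : ℕ, ∑ k ∈ Finset.range n, a k ≤
      n * c + ∑ k ∈ Finset.range n, e k + max 0 (Real.log (d n) - Real.log τ) := by
    intro n
    induction n with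
    | zero => simp
    | succ n ih =>
      rw [Finset.sum_range_succ, Finset.sum_range_succ]
      push_cast
      rcases lt_or_ge (d n) τ with hlt | hge
      · have h1 := (abs_le.1 (hsmall n (Or.inl hlt))).2
        have h2 := Real.log_lt_log (hd n) hlt
        rw [max_eq_left (by linarith)] at ih
        linarith [he n, le_max_left 0 (Real.log (d (n + 1)) - Real.log τ)]
      · have h1 := (abs_le.1 (hade n)).2
        have h2 := Real.log_le_log hτ hge
        rw [max_eq_right (by linarith)] at ih
        linarith [le_max_right 0 (Real.log (d (n + 1)) - Real.log τ)]
  have hlower : ∀ n : ℕ, -∑ k ∈ Finset.range n, a k ≤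
      n * c + ∑ k ∈ Finset.range n, e k - Real.log τ
        - max 0 (Real.log (d n) - Real.log τ) := by
    intro n
    induction n with
    | zero =>
      have : max 0 (Real.log (d 0) - Real.log τ) ≤ -Real.log τ :=
        max_le (by linarith) (by linarith [hdlog 0])
      simp only [Finset.range_zero, Finset.sum_empty, neg_zero, Nat.cast_zero, zero_mul, zero_add]
      linarith
    | succ n ih =>
      rw [Finset.sum_range_succ, Finset.sum_range_succ]
      push_cast
      rcases lt_or_ge (d (n + 1)) τ with hlt | hge
      · have h1 := (abs_le.1 (hsmall n (Or.inr hlt))).1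
        have h2 := Real.log_lt_log (hd _) hlt
        rw [max_eq_left (a := (0:ℝ)) (b := Real.log (d (n + 1)) - Real.log τ) (by linarith)]
        linarith [he n, le_max_left 0 (Real.log (d n) - Real.log τ)]
      · have h1 := (abs_le.1 (hade n)).1
        have h2 := Real.log_le_log hτ hge
        rw [max_eq_right (a := (0:ℝ)) (b := Real.log (d (n + 1)) - Real.log τ) (by linarith)]
        linarith [le_max_right 0 (Real.log (d n) - Real.log τ)]
  refine abs_le'.2 ⟨(hupper n).trans ?_, (hlower n).trans ?_⟩
  · have : max 0 (Real.log (d n) - Real.log τ) ≤ -Real.log τ :=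
      max_le (by linarith) (by linarith [hdlog n])
    linarith
  · linarith [le_max_left 0 (Real.log (d n) - Real.log τ)]

theorem abs_log_sub_log_le_s5 {m p q : ℝ} (hm : 0 < m) (hp : m ≤ p) (hq : m ≤ q) :
    |Real.log p - Real.log q| ≤ |p - q| / m := by
  have key : ∀ a b : ℝ, m ≤ a → m ≤ b → Real.log a - Real.log b ≤ |a - b| / m := by
    intro a b ha hb
    have ha0 : 0 < a := hm.trans_le ha
    have hb0 : 0 < b := hm.trans_le hb
    rw [← Real.log_div ha0.ne' hb0.ne']
    calc Real.log (a / b) ≤ a / b - 1 := Real.log_le_sub_one_of_pos (by positivity)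
      _ = (a - b) / b := by field_simp
      _ ≤ |a - b| / b := by gcongr; exact le_abs_self _
      _ ≤ |a - b| / m := by gcongr
  refine abs_le'.2 ⟨key p q hp hq, ?_⟩
  rw [neg_sub, abs_sub_comm]
  exact key q p hq hp

theorem abs_log_le_of_abs_sub_one_le {p s : ℝ} (hs : s ≤ 1 / 2) (hp : |p - 1| ≤ s) :
    |Real.log p| ≤ 2 * s := by
  obtain ⟨h1, h2⟩ := abs_le.1 hp
  have h := abs_log_sub_log_le_s5 (m := 1 / 2) (p := p) (q := 1) (by norm_num) (by linarith)
    (by norm_num)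
  rw [Real.log_one, sub_zero] at h
  linarith

theorem IsDiff01.abs_log_prod_le {f g ω : ℝ → ℝ} (hf : IsDiff01 f g) (hω : IsModCont ω)
    (hfix : ∀ p ∈ Icc (0:ℝ) 1, f p = p → derivWithin f (Icc (0:ℝ) 1) p = 1)
    {C m h s B : ℝ} (hC : 0 < C)
    (hmod : ∀ x ∈ Icc (0:ℝ) 1, ∀ y ∈ Icc (0:ℝ) 1,
      |derivWithin f (Icc (0:ℝ) 1) x - derivWithin f (Icc (0:ℝ) 1) y| ≤ C * ω |x - y|)
    (hm : 0 < m) (hm1 : m ≤ 1) (hmφ : ∀ x ∈ Icc (0:ℝ) 1, m ≤ derivWithin f (Icc (0:ℝ) 1) x)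
    (hh : 0 < h) (hh1 : h ≤ 1) (hs : 0 < s) (hs1 : s ≤ 1 / 2) (hCh : C * ω h ≤ s / 2)
    {n : ℕ} (hn : 0 < n) (hB : 0 ≤ B) (hωB : ∀ d ∈ Icc (0:ℝ) 1, ω d ≤ (d + 1 / n) * B)
    {x : ℝ} (hx : x ∈ Icc (0:ℝ) 1) :
    |Real.log (∏ k ∈ Finset.range n, derivWithin f (Icc (0:ℝ) 1) (f^[k] x))| ≤
      n * (2 * s) + C / m * (2 * B) - Real.log (m * (h * s / 2)) := by
  set φ := derivWithin f (Icc (0:ℝ) 1)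
  have hmem : ∀ k, f^[k] x ∈ Icc (0:ℝ) 1 := fun k => hf.mapsTo.iterate k hx
  have hτ0 : 0 < h * s / 2 := by positivity
  have hτ1 : h * s / 2 ≤ 1 := by nlinarith
  have hmτ : m * (h * s / 2) ≤ h * s / 2 := by nlinarith
  by_cases hfx : f x = x
  · have : ∀ k, f^[k] x = x := fun k => Function.iterate_fixed hfx k
    have hlog : Real.log (m * (h * s / 2)) ≤ 0 :=
      Real.log_nonpos (by positivity) (hmτ.trans hτ1)
    have h1 : 0 ≤ n * (2 * s) + C / m * (2 * B) := by positivity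
    simp only [this, hfix x hx hfx, Finset.prod_const_one, Real.log_one, abs_zero]
    linarith
  set d : ℕ → ℝ := fun k => |f^[k + 1] x - f^[k] x| with hd
  have hne : ∀ k, f^[k + 1] x ≠ f^[k] x := by
    intro k
    induction k with
    | zero => simpa using hfx
    | succ k ih =>
      rw [Function.iterate_succ_apply' f k, Function.iterate_succ_apply' f (k + 1)]
      exact fun h => ih (hf.strictMonoOn.injOn (hmem _) (hmem _) h)
  have hd0 : ∀ k, 0 < d k := fun k => abs_pos.2 (sub_ne_zero.2 (hne k))
  have hd1 : ∀ k, d k ≤ 1 := fun k =>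
    abs_le.2 ⟨by linarith [(hmem k).2, (hmem (k + 1)).1], by linarith [(hmem k).1, (hmem (k + 1)).2]⟩
  have hstep : ∀ k, ∃ z ∈ Icc (0:ℝ) 1, |f^[k] x - z| ≤ d k ∧ d (k + 1) = φ z * d k := by
    intro k
    obtain ⟨z, hz, hzd, e⟩ := hf.exists_sub_eq_derivWithin_mul (hmem k) (hmem (k + 1))
    refine ⟨z, hz, hzd, ?_⟩
    rw [← Function.iterate_succ_apply' f, ← Function.iterate_succ_apply' f] at e
    change |_| = _ * |_|
    rw [e, abs_mul, abs_of_pos (hf.deriv_pos z hz)]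
  have hdm : ∀ k, m * d k ≤ d (k + 1) := by
    intro k
    obtain ⟨z, hz, -, e⟩ := hstep k
    rw [e]
    exact mul_le_mul_of_nonneg_right (hmφ z hz) (hd0 k).le
  have hsmall : ∀ y ∈ Icc (0:ℝ) 1, |f y - y| < h * s / 2 → |φ y - 1| ≤ s := by
    intro y hy hlt
    refine abs_deriv_le_of_small (u := fun y => f y - y) (u' := fun y => φ y - 1) hh hs
      (fun z hz => (hf.differentiableOn z hz).hasDerivWithinAt.sub (hasDerivWithinAt_id z _))
      (fun z hz w hw hzw => ?_) (fun z hz h0 => ?_) ?_ ?_ hy hlt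
    · rw [sub_sub_sub_cancel_right]
      refine (hmod z hz w hw).trans (le_trans ?_ hCh)
      gcongr
      exact hω.monotoneOn ⟨abs_nonneg _, hzw.trans hh1⟩ ⟨hh.le, hh1⟩ hzw
    · simp [hfix z hz (sub_eq_zero.1 h0)]
    · simp [hf.map_zero]
    · simp [hf.map_one]
  have hsum := abs_sum_le_of_threshold (a := fun k => Real.log (φ (f^[k] x))) (d := d)
    (e := fun k => C / m * ω (d k)) (c := 2 * s) (τ := m * (h * s / 2)) (by positivity)
    (hmτ.trans hτ1) (by positivity) hd0 hd1
    (fun k => mul_nonneg (by positivity) (hω.nonneg _ ⟨(hd0 k).le, hd1 k⟩))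
    (fun k => by
      obtain ⟨z, hz, hzd, e⟩ := hstep k
      have hφz : 0 < φ z := hf.deriv_pos z hz
      rw [e, Real.log_mul hφz.ne' (hd0 k).ne', add_sub_cancel_right]
      calc _ ≤ |φ (f^[k] x) - φ z| / m := abs_log_sub_log_le_s5 hm (hmφ _ (hmem k)) (hmφ z hz)
        _ ≤ C * ω |f^[k] x - z| / m := by gcongr; exact hmod _ (hmem k) z hz
        _ ≤ C * ω (d k) / m := by
          gcongr
          exact hω.monotoneOn ⟨abs_nonneg _, hzd.trans (hd1 k)⟩ ⟨(hd0 k).le, hd1 k⟩ hzd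
        _ = C / m * ω (d k) := by ring)
    (fun k hk => by
      have hk' : d k < h * s / 2 := by
        rcases hk with hk | hk
        · exact hk.trans_le hmτ
        · exact lt_of_mul_lt_mul_left ((hdm k).trans_lt hk) hm.le
      refine abs_log_le_of_abs_sub_one_le hs1 (hsmall _ (hmem k) ?_)
      rwa [← Function.iterate_succ_apply' f])
    n
  have hωsum : ∑ k ∈ Finset.range n, ω (d k) ≤ 2 * B := by
    calc ∑ k ∈ Finset.range n, ω (d k) ≤ ∑ k ∈ Finset.range n, (d k + 1 / n) * B :=
          Finset.sum_le_sum fun k _ => hωB _ ⟨(hd0 k).le, hd1 k⟩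
      _ = (∑ k ∈ Finset.range n, d k + 1) * B := by
          have hn' : (n:ℝ) ≠ 0 := by positivity
          rw [← Finset.sum_mul, Finset.sum_add_distrib]
          simp [hn']
      _ ≤ 2 * B := by
          gcongr
          linarith [hf.sum_abs_step_le_one hx n]
  rw [Real.log_prod fun k _ => (hf.deriv_pos _ (hmem k)).ne']
  refine hsum.trans ?_
  rw [← Finset.mul_sum]
  gcongr

theorem supAbsDeriv_le {F : ℝ → ℝ} {b : ℝ}
    (h : ∀ x ∈ Icc (0:ℝ) 1, |derivWithin F (Icc (0:ℝ) 1) x| ≤ b) : supAbsDeriv F ≤ b := by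
  refine csSup_le (Nonempty.image _ ⟨0, by simp⟩) ?_
  rintro _ ⟨x, hx, rfl⟩
  exact h x hx

theorem IsDiff01.log_Gamma_le {f g : ℝ → ℝ} (hf : IsDiff01 f g) {n : ℕ} {b : ℝ}
    (h : ∀ x ∈ Icc (0:ℝ) 1,
      |Real.log (∏ k ∈ Finset.range n, derivWithin f (Icc (0:ℝ) 1) (f^[k] x))| ≤ b) :
    Real.log (Gamma f g n) ≤ b := by
  have hpos : ∀ x ∈ Icc (0:ℝ) 1,
      0 < ∏ k ∈ Finset.range n, derivWithin f (Icc (0:ℝ) 1) (f^[k] x) := fun x hx =>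
    Finset.prod_pos fun k _ => hf.deriv_pos _ (hf.mapsTo.iterate k hx)
  have hfn : supAbsDeriv f^[n] ≤ Real.exp b := by
    refine supAbsDeriv_le fun x hx => ?_
    rw [derivWithin_iterate (uniqueDiffOn_Icc one_pos) hf.mapsTo hf.differentiableOn n hx,
      abs_of_pos (hpos x hx), ← Real.log_le_iff_le_exp (hpos x hx)]
    exact (abs_le.1 (h x hx)).2
  have hgn : supAbsDeriv g^[n] ≤ Real.exp b := by
    refine supAbsDeriv_le fun y hy => ?_
    have hx := hf.inv_mapsTo.iterate n hy
    rw [hf.derivWithin_inv_iterate n hy, abs_of_pos (inv_pos.2 (hpos _ hx)),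
      ← Real.log_le_iff_le_exp (inv_pos.2 (hpos _ hx)), Real.log_inv]
    linarith [(abs_le.1 (h _ hx)).1]
  have hΓ : 0 < Gamma f g n := by
    have h0 : (0:ℝ) ∈ Icc (0:ℝ) 1 := by simp
    refine lt_of_lt_of_le ?_ ((abs_derivWithin_iterate_le_supAbsDeriv hf.mapsTo hf.contDiffOn n
      h0).trans (le_max_left _ _))
    rw [derivWithin_iterate (uniqueDiffOn_Icc one_pos) hf.mapsTo hf.differentiableOn n h0]
    exact abs_pos.2 (hpos 0 h0).ne'
  exact (Real.log_le_iff_le_exp hΓ).2 (max_le hfn hgn)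

theorem eventually_log_Gamma_le {ω f g : ℝ → ℝ} (hω : IsModCont ω)
    (hlim : Tendsto (fun x => ω x / (x * Real.log (Real.exp 1 / x))) (nhdsWithin 0 (Ioi 0))
      (nhds 0))
    (hf : IsDiff01 f g) (hfω : InDiffOmega ω f) (hγ : GammaEqOne f g) {ε : ℝ} (hε : 0 < ε) :
    ∀ᶠ n : ℕ in atTop, Real.log (Gamma f g n) ≤ (2 + ε) * Real.log n := by
  obtain ⟨C, hC, hmod⟩ := hfω
  have hfix : ∀ p ∈ Icc (0:ℝ) 1, f p = p → derivWithin f (Icc (0:ℝ) 1) p = 1 :=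
    fun p hp => hf.derivWithin_eq_one_of_fixed hγ hp
  obtain ⟨x₀, hx₀, hmin⟩ := isCompact_Icc.exists_isMinOn (nonempty_Icc.2 zero_le_one)
    (hf.contDiffOn.continuousOn_derivWithin (uniqueDiffOn_Icc (one_pos (α := ℝ))) le_rfl)
  set m := derivWithin f (Icc (0:ℝ) 1) x₀
  have hm : 0 < m := hf.deriv_pos x₀ hx₀
  have hmφ : ∀ x ∈ Icc (0:ℝ) 1, m ≤ derivWithin f (Icc (0:ℝ) 1) x := fun x hx => hmin hx
  have hm1 : m ≤ 1 := by
    have h0 : (0:ℝ) ∈ Icc (0:ℝ) 1 := by simp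
    simpa [hfix 0 h0 hf.map_zero] using hmφ 0 h0
  obtain ⟨K, hK, hωK⟩ := hω.le_mul_log hlim (η := ε * m / (8 * C)) (by positivity)
  set η := ε * m / (8 * C) with hη
  have hη0 : 0 < η := by positivity
  have hlogn : Tendsto (fun n : ℕ => Real.log n) atTop atTop :=
    Real.tendsto_log_atTop.comp tendsto_natCast_atTop_atTop
  have hexp : ∀ᶠ L : ℝ in atTop,
      C * (η * (1 + (1 + ε / 4) * L) + K) ≤ Real.exp (ε / 4 * L) / 2 := by
    have hlin : Tendsto (fun L : ℝ => ε ^ 2 / 64 * L) atTop atTop :=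
      tendsto_id.const_mul_atTop (by positivity)
    filter_upwards [hlin.eventually_ge_atTop (C * (η * (1 + (1 + ε / 4)) + K)),
      eventually_ge_atTop 1] with L hL hL1
    have h1 := Real.quadratic_le_exp_of_nonneg (x := ε / 4 * L) (by positivity)
    have h2 : C * (η * (1 + (1 + ε / 4) * L) + K) ≤ C * (η * (1 + (1 + ε / 4)) + K) * L := by
      have : 0 ≤ C * (η + K) := by positivity
      nlinarith
    have h3 : C * (η * (1 + (1 + ε / 4)) + K) * L ≤ ε ^ 2 / 64 * L * L := by gcongr
    have h4 : 0 ≤ ε / 4 * L := by positivity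
    nlinarith
  have hconst := (hlogn.const_mul_atTop (half_pos hε)).eventually_ge_atTop
    (2 + ε / 4 + 2 * C * K / m - Real.log (m / 2))
  filter_upwards [hlogn.eventually hexp, hconst, eventually_ge_atTop 2] with n hnexp hnconst hn2
  set L := Real.log n
  have hn0 : (0:ℝ) < n := by positivity
  have hn2' : (2:ℝ) ≤ n := by exact_mod_cast hn2
  have hL0 : 0 ≤ L := Real.log_nonneg (by linarith)
  set h : ℝ := 1 / n * Real.exp (-(ε / 4 * L)) with hhdef
  have hh : 0 < h := by positivity
  have hn1 : 1 / (n:ℝ) ≤ 1 / 2 := by gcongr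
  have hh1 : h ≤ 1 := by
    have : Real.exp (-(ε / 4 * L)) ≤ 1 := Real.exp_le_one_iff.2 (by
      have : 0 ≤ ε / 4 * L := by positivity
      linarith)
    have h0 : 0 < 1 / (n:ℝ) := by positivity
    nlinarith
  have hlogh : Real.log h = -L - ε / 4 * L := by
    rw [hhdef, Real.log_mul (by positivity) (Real.exp_pos _).ne', Real.log_exp, one_div,
      Real.log_inv]
    ring
  have hCh : C * ω h ≤ 1 / n / 2 := by
    have h1 := hωK h ⟨hh, hh1⟩
    rw [hlogh] at h1
    calc C * ω h ≤ C * (h * (η * (1 - (-L - ε / 4 * L)) + K)) := by gcongr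
      _ = h * (C * (η * (1 + (1 + ε / 4) * L) + K)) := by ring
      _ ≤ h * (Real.exp (ε / 4 * L) / 2) := by gcongr
      _ = 1 / n / 2 := by
        rw [hhdef, Real.exp_neg]
        field_simp
  have hB : 0 ≤ η * (1 + L) + K := by positivity
  have hωB : ∀ d ∈ Icc (0:ℝ) 1, ω d ≤ (d + 1 / n) * (η * (1 + L) + K) := by
    intro d hd
    rcases le_total d (1 / n) with hdn | hdn
    · have hmem : 1 / (n:ℝ) ∈ Ioc (0:ℝ) 1 := ⟨by positivity, by linarith⟩
      have h1 := hωK _ hmem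
      rw [one_div, Real.log_inv, sub_neg_eq_add, ← one_div] at h1
      calc ω d ≤ ω (1 / n) := hω.monotoneOn hd ⟨hmem.1.le, hmem.2⟩ hdn
        _ ≤ 1 / n * (η * (1 + L) + K) := h1
        _ ≤ _ := by gcongr; linarith [hd.1]
    · have hd0 : 0 < d := lt_of_lt_of_le (by positivity) hdn
      have hlogd : -L ≤ Real.log d := by
        have := Real.log_le_log (by positivity) hdn
        rwa [one_div, Real.log_inv] at this
      calc ω d ≤ d * (η * (1 - Real.log d) + K) := hωK d ⟨hd0, hd.2⟩
        _ ≤ d * (η * (1 + L) + K) := by gcongr; linarith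
        _ ≤ _ := by gcongr; linarith [show 0 < 1 / (n:ℝ) by positivity]
  have hbound := hf.log_Gamma_le fun x hx => hf.abs_log_prod_le hω hfix hC hmod hm hm1 hmφ hh hh1
    (s := 1 / n) (by positivity) hn1 hCh (by omega) hB hωB hx
  refine hbound.trans ?_
  have hlogτ : Real.log (m * (h * (1 / n) / 2)) = Real.log (m / 2) - (2 + ε / 4) * L := by
    rw [show m * (h * (1 / n) / 2) = m / 2 * (h * (n:ℝ)⁻¹) by ring,
      Real.log_mul (by positivity) (by positivity), Real.log_mul hh.ne' (by positivity), hlogh,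
      Real.log_inv]
    ring
  have hCB : C / m * (2 * (η * (1 + L) + K)) = ε / 4 + ε / 4 * L + 2 * C * K / m := by
    rw [hη]
    field_simp
    ring
  have hns : (n:ℝ) * (2 * (1 / n)) = 2 := by field_simp
  rw [hlogτ, hCB, hns]
  linarith

theorem IsModCont.eventually_two_mul_log_le {ω winv : ℝ → ℝ} (hω : IsModCont ω) (hω1 : 0 < ω 1)
    (hwinv : ∀ x ∈ Icc (0:ℝ) 1, winv (ω x) = x) :
    ∀ᶠ n : ℕ in atTop, 2 * Real.log n + Real.log (ω 1 / 4) ≤ Real.log (n / winv (2 / n)) := by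
  have h2 : Tendsto (fun n : ℕ => 2 / (n:ℝ)) atTop (nhds 0) :=
    tendsto_const_div_atTop_nhds_zero_nat 2
  filter_upwards [h2.eventually_le_const hω1, eventually_ge_atTop 1] with n hn hn1
  have hn0 : (0:ℝ) < n := by positivity
  obtain ⟨x, hx, hωx⟩ := intermediate_value_Icc zero_le_one hω.continuousOn
    (show 2 / (n:ℝ) ∈ Icc (ω 0) (ω 1) from ⟨by rw [hω.map_zero]; positivity, hn⟩)
  rw [← hωx, hwinv x hx]
  have hx0 : 0 < x := by
    refine lt_of_le_of_ne hx.1 fun h => ?_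
    rw [← h, hω.map_zero] at hωx
    have : 0 < 2 / (n:ℝ) := by positivity
    linarith
  have hlin := hω.linear_le ⟨hx0, hx.2⟩
  rw [hωx] at hlin
  have heq : 2 * Real.log n + Real.log (ω 1 / 4) = Real.log (n ^ 2 * (ω 1 / 4)) := by
    rw [Real.log_mul (by positivity) (by positivity), Real.log_pow]
    norm_num
  rw [heq]
  refine Real.log_le_log (by positivity) ?_
  rw [le_div_iff₀ hx0]
  calc (n:ℝ) ^ 2 * (ω 1 / 4) * x = (n:ℝ) ^ 2 / 4 * (ω 1 * x) := by ring
    _ ≤ (n:ℝ) ^ 2 / 4 * (2 * (2 / n)) := by gcongr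
    _ = (n:ℝ) := by field_simp; norm_num

/-- **Corollary 1(2).** If moreover `lim_{x→0⁺} ω(x)/(x log(e/x)) = 0`, then
`log Γ_n(f) ≤ (1 + o(1)) · log (n / ω⁻¹(2/n))`. -/
theorem growth_gap_modulus_small (ω : ℝ → ℝ) (hω : IsModCont ω)
    (hsm : StrictMonoOn ω (Set.Icc (0:ℝ) 1))
    (hlim : Filter.Tendsto (fun x => ω x / (x * Real.log (Real.exp 1 / x)))
      (nhdsWithin 0 (Set.Ioi 0)) (nhds 0))
    (winv : ℝ → ℝ) (hwinv : ∀ x ∈ Set.Icc (0:ℝ) 1, winv (ω x) = x)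
    (f g : ℝ → ℝ) (hf : IsDiff01 f g) (hfω : InDiffOmega ω f) (hγ : GammaEqOne f g) :
    ∀ ε > 0, ∃ N : ℕ, ∀ n : ℕ, N ≤ n →
      Real.log (Gamma f g n) ≤ (1 + ε) * Real.log ((n:ℝ) / winv (2 / (n:ℝ))) := by
  intro ε hε
  have hω1 : 0 < ω 1 := by
    have := hsm (show (0:ℝ) ∈ Icc (0:ℝ) 1 by simp) (show (1:ℝ) ∈ Icc (0:ℝ) 1 by simp) one_pos
    rwa [hω.map_zero] at this
  have hlogn : Tendsto (fun n : ℕ => Real.log n) atTop atTop :=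
    Real.tendsto_log_atTop.comp tendsto_natCast_atTop_atTop
  rw [← eventually_atTop]
  filter_upwards [eventually_log_Gamma_le hω hlim hf hfω hγ hε,
    hω.eventually_two_mul_log_le hω1 hwinv,
    (hlogn.const_mul_atTop hε).eventually_ge_atTop (-((1 + ε) * Real.log (ω 1 / 4)))]
    with n hΓ hinv hlarge
  calc Real.log (Gamma f g n) ≤ (2 + ε) * Real.log n := hΓ
    _ ≤ (1 + ε) * (2 * Real.log n + Real.log (ω 1 / 4)) := by linarith
    _ ≤ _ := by gcongr
end

section
/- Let ω : [0,1] → [0,∞) be a modulus of continuity such that for some 0 < α < 1 and some 0 < a < 1 the function x ↦ ω(x)/x^α is decreasing on (0,a). Then for every f ∈ Diff₀^ω[0,1] with γ(f) = 1 there exists a constant C(f) > 0 such that log Γ_n(f) ≤ C(f) · n · ω(1/n) for all n ∈ ℕ. -/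
open Set Filter

namespace IsModCont

variable {ω : ℝ → ℝ}

theorem natCast_mul_le (hω : IsModCont ω) {t : ℝ} (ht : 0 ≤ t) (k : ℕ) (hk : k * t ≤ 1) :
    ω (k * t) ≤ k * ω t := by
  induction k with
  | zero => simp [hω.map_zero]
  | succ k ih =>
    push_cast at hk ⊢
    have h1 : (k + 1 : ℝ) * t = k * t + t := by ring
    rw [h1] at hk ⊢
    have h2 := hω.subadd (k * t) t (by positivity) ht hk
    have h3 := ih (by linarith)
    linarith

theorem le_div_add_one_mul (hω : IsModCont ω) {d t : ℝ} (hd : d ∈ Icc (0 : ℝ) 1) (ht0 : 0 < t)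
    (ht1 : t ≤ 1) : ω d ≤ (d / t + 1) * ω t := by
  have hk : (⌊d / t⌋₊ : ℝ) ≤ d / t := Nat.floor_le (div_nonneg hd.1 ht0.le)
  have hk' : d / t < ⌊d / t⌋₊ + 1 := Nat.lt_floor_add_one _
  set k : ℕ := ⌊d / t⌋₊
  have h1 : k * t ≤ d := (le_div_iff₀ ht0).1 hk
  have h2 : d < (k + 1) * t := (div_lt_iff₀ ht0).1 hk'
  have h3 := hω.subadd (k * t) (d - k * t) (by positivity) (by linarith) (by linarith [hd.2])
  have h4 := hω.natCast_mul_le ht0.le k (h1.trans hd.2)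
  have h5 : ω (d - k * t) ≤ ω t :=
    hω.monotoneOn ⟨by linarith, by linarith⟩ ⟨ht0.le, ht1⟩ (by linarith)
  have h6 := mul_le_mul_of_nonneg_right hk (hω.nonneg t ⟨ht0.le, ht1⟩)
  rw [add_sub_cancel] at h3
  linarith

theorem apply_one_mul_le (hω : IsModCont ω) {t : ℝ} (ht0 : 0 < t) (ht1 : t ≤ 1) :
    ω 1 * t ≤ 2 * ω t := by
  have h := hω.le_div_add_one_mul (right_mem_Icc.2 zero_le_one) ht0 ht1
  have h0 := hω.nonneg t ⟨ht0.le, ht1⟩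
  calc ω 1 * t ≤ (1 / t + 1) * ω t * t := by gcongr
    _ = (1 + t) * ω t := by field_simp
    _ ≤ 2 * ω t := by gcongr; linarith

theorem mul_rpow_le (hω : IsModCont ω) {α a : ℝ} (hα0 : 0 < α) (ha0 : 0 < a) (ha1 : a < 1)
    (hdec : AntitoneOn (fun x => ω x / x ^ α) (Ioo 0 a)) {x : ℝ} (hx0 : 0 < x) (hx1 : x ≤ 1) :
    ω (a / 2) * x ^ α ≤ ω x := by
  have hpos := hω.nonneg (a / 2) ⟨by linarith, by linarith⟩
  rcases le_total x (a / 2) with h | h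
  · have h1 := hdec ⟨hx0, by linarith⟩ ⟨by linarith, by linarith⟩ h
    have h2 : ω (a / 2) ≤ ω (a / 2) / (a / 2) ^ α :=
      le_div_self hpos (by positivity) (Real.rpow_le_one (by linarith) (by linarith) hα0.le)
    exact (le_div_iff₀ (by positivity)).1 (h2.trans h1)
  · calc ω (a / 2) * x ^ α ≤ ω (a / 2) * 1 := by
          gcongr; exact Real.rpow_le_one hx0.le hx1 hα0.le
      _ ≤ ω x := by
          rw [mul_one]
          exact hω.monotoneOn ⟨by linarith, by linarith⟩ ⟨hx0.le, hx1⟩ h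

theorem exists_log_le (hω : IsModCont ω) {α a : ℝ} (hα0 : 0 < α) (hα1 : α < 1) (ha0 : 0 < a)
    (ha1 : a < 1) (hdec : AntitoneOn (fun x => ω x / x ^ α) (Ioo 0 a)) (h1 : 0 < ω 1) :
    ∃ K, 0 ≤ K ∧ ∀ n : ℕ, 1 ≤ n → Real.log n ≤ K * (n * ω (1 / (n : ℝ))) := by
  have hc : 0 < ω (a / 2) := by
    have := hω.apply_one_mul_le (t := a / 2) (by linarith) (by linarith)
    have : 0 < ω 1 * (a / 2) := by positivity
    linarith
  have hβ : 0 < 1 - α := by linarith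
  refine ⟨1 / ((1 - α) * ω (a / 2)), by positivity, fun n hn => ?_⟩
  have hn0 : (0 : ℝ) < n := by exact_mod_cast hn
  have hlog := Real.log_le_rpow_div hn0.le hβ
  have hr := hω.mul_rpow_le hα0 ha0 ha1 hdec (x := 1 / (n : ℝ)) (by positivity)
    ((div_le_one hn0).2 (by exact_mod_cast hn))
  have he : (n : ℝ) ^ (1 - α) = n * (1 / (n : ℝ)) ^ α := by
    rw [Real.rpow_sub hn0, Real.rpow_one, one_div, Real.inv_rpow hn0.le]; rfl
  rw [he] at hlog
  calc Real.log n ≤ n * (1 / (n : ℝ)) ^ α / (1 - α) := hlog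
    _ = 1 / ((1 - α) * ω (a / 2)) * (n * (ω (a / 2) * (1 / (n : ℝ)) ^ α)) := by
      field_simp
    _ ≤ _ := by gcongr

end IsModCont

namespace IsDiff01

variable {f g : ℝ → ℝ}

theorem hasDerivWithinAt (hf : IsDiff01 f g) {x : ℝ} (hx : x ∈ Icc (0 : ℝ) 1) :
    HasDerivWithinAt f (derivWithin f (Icc 0 1) x) (Icc 0 1) x :=
  (hf.contDiffOn.differentiableOn one_ne_zero x hx).hasDerivWithinAt

theorem inv_hasDerivWithinAt (hf : IsDiff01 f g) {x : ℝ} (hx : x ∈ Icc (0 : ℝ) 1) :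
    HasDerivWithinAt g (derivWithin g (Icc 0 1) x) (Icc 0 1) x :=
  (hf.inv_contDiffOn.differentiableOn one_ne_zero x hx).hasDerivWithinAt

theorem deriv_mul_inv_deriv (hf : IsDiff01 f g) {x : ℝ} (hx : x ∈ Icc (0 : ℝ) 1) :
    derivWithin f (Icc 0 1) (g x) * derivWithin g (Icc 0 1) x = 1 := by
  have h1 := (hf.hasDerivWithinAt (hf.inv_mapsTo hx)).comp x (hf.inv_hasDerivWithinAt hx)
    hf.inv_mapsTo
  have h2 : HasDerivWithinAt (f ∘ g) 1 (Icc 0 1) x :=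
    (hasDerivWithinAt_id x _).congr (fun y hy => hf.right_inv y hy) (hf.right_inv x hx)
  exact (uniqueDiffOn_Icc zero_lt_one x hx).eq_deriv _ h1 h2

theorem symm (hf : IsDiff01 f g) : IsDiff01 g f where
  mapsTo := hf.inv_mapsTo
  inv_mapsTo := hf.mapsTo
  left_inv := hf.right_inv
  right_inv := hf.left_inv
  map_zero := by simpa [hf.map_zero] using hf.left_inv 0 (by simp)
  map_one := by simpa [hf.map_one] using hf.left_inv 1 (by simp)
  contDiffOn := hf.inv_contDiffOn
  inv_contDiffOn := hf.contDiffOn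
  deriv_pos x hx := by
    refine pos_of_mul_pos_right (a := derivWithin f (Icc 0 1) (g x)) ?_
      (hf.deriv_pos _ (hf.inv_mapsTo hx)).le
    rw [hf.deriv_mul_inv_deriv hx]
    exact one_pos

theorem exists_deriv_lower_bound (hf : IsDiff01 f g) :
    ∃ m > 0, ∀ x ∈ Icc (0 : ℝ) 1, m ≤ derivWithin f (Icc 0 1) x := by
  obtain ⟨z, hz, hmin⟩ := isCompact_Icc.exists_isMinOn (nonempty_Icc.2 zero_le_one)
    (hf.contDiffOn.continuousOn_derivWithin (uniqueDiffOn_Icc zero_lt_one) le_rfl)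
  exact ⟨_, hf.deriv_pos z hz, fun x hx => hmin hx⟩

theorem exists_slope_of_lt (hf : IsDiff01 f g) {x y : ℝ} (hx : x ∈ Icc (0 : ℝ) 1)
    (hy : y ∈ Icc (0 : ℝ) 1) (hxy : x < y) :
    ∃ ξ ∈ Ioo x y, f y - f x = derivWithin f (Icc 0 1) ξ * (y - x) := by
  obtain ⟨ξ, hξ, h⟩ := exists_hasDerivAt_eq_slope f (derivWithin f (Icc 0 1)) hxy
    (hf.contDiffOn.continuousOn.mono (Icc_subset_Icc hx.1 hy.2)) (fun z hz =>
      (hf.hasDerivWithinAt ⟨hx.1.trans hz.1.le, hz.2.le.trans hy.2⟩).hasDerivAt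
        (Icc_mem_nhds (hx.1.trans_lt hz.1) (hz.2.trans_le hy.2)))
  refine ⟨ξ, hξ, ?_⟩
  rw [h, div_mul_cancel₀ _ (by linarith)]

theorem exists_slope (hf : IsDiff01 f g) {x y : ℝ} (hx : x ∈ Icc (0 : ℝ) 1)
    (hy : y ∈ Icc (0 : ℝ) 1) :
    ∃ ξ ∈ Icc (0 : ℝ) 1, |x - ξ| ≤ |y - x| ∧
      f y - f x = derivWithin f (Icc 0 1) ξ * (y - x) := by
  rcases lt_trichotomy x y with h | h | h
  · obtain ⟨ξ, hξ, he⟩ := hf.exists_slope_of_lt hx hy h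
    refine ⟨ξ, ⟨hx.1.trans hξ.1.le, hξ.2.le.trans hy.2⟩, ?_, he⟩
    rw [abs_of_nonpos (by linarith [hξ.1]), abs_of_pos (by linarith)]
    linarith [hξ.2]
  · subst h
    exact ⟨x, hx, by simp, by simp⟩
  · obtain ⟨ξ, hξ, he⟩ := hf.exists_slope_of_lt hy hx h
    refine ⟨ξ, ⟨hy.1.trans hξ.1.le, hξ.2.le.trans hx.2⟩, ?_, by linarith⟩
    rw [abs_of_pos (by linarith [hξ.2]), abs_of_neg (by linarith)]
    linarith [hξ.1]

theorem monotoneOn (hf : IsDiff01 f g) : MonotoneOn f (Icc 0 1) := by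
  intro x hx y hy hxy
  obtain ⟨ξ, hξ, -, he⟩ := hf.exists_slope hx hy
  have := mul_nonneg (hf.deriv_pos ξ hξ).le (sub_nonneg.2 hxy)
  linarith

theorem iterate_mem (hf : IsDiff01 f g) {x : ℝ} (hx : x ∈ Icc (0 : ℝ) 1) (n : ℕ) :
    f^[n] x ∈ Icc (0 : ℝ) 1 :=
  hf.mapsTo.iterate n hx

theorem derivWithin_iterate (hf : IsDiff01 f g) {x : ℝ} (hx : x ∈ Icc (0 : ℝ) 1) (n : ℕ) :
    derivWithin f^[n] (Icc 0 1) x =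
      ∏ k ∈ Finset.range n, derivWithin f (Icc 0 1) (f^[k] x) := by
  have h : HasDerivWithinAt f^[n]
      (∏ k ∈ Finset.range n, derivWithin f (Icc 0 1) (f^[k] x)) (Icc 0 1) x := by
    induction n with
    | zero => simpa using hasDerivWithinAt_id x (Icc (0 : ℝ) 1)
    | succ n ih =>
      rw [Function.iterate_succ', Finset.prod_range_succ, mul_comm]
      exact (hf.hasDerivWithinAt (hf.iterate_mem hx n)).comp x ih (hf.mapsTo.iterate n)
  exact h.derivWithin (uniqueDiffOn_Icc zero_lt_one x hx)

theorem sum_abs_iterate_sub_le (hf : IsDiff01 f g) {x : ℝ} (hx : x ∈ Icc (0 : ℝ) 1) (n : ℕ) :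
    ∑ k ∈ Finset.range n, |f^[k + 1] x - f^[k] x| ≤ 1 := by
  have hn := hf.iterate_mem hx n
  rcases le_total x (f x) with h | h
  · have hmono : ∀ k, f^[k] x ≤ f^[k + 1] x := by
      intro k
      induction k with
      | zero => simpa using h
      | succ k ih =>
        rw [Function.iterate_succ_apply' f k, Function.iterate_succ_apply' f (k + 1)]
        exact hf.monotoneOn (hf.iterate_mem hx k) (hf.iterate_mem hx (k + 1)) ih
    rw [Finset.sum_congr rfl fun k _ => abs_of_nonneg (sub_nonneg.2 (hmono k)),
      Finset.sum_range_sub (fun k => f^[k] x)]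
    simp only [Function.iterate_zero, id]
    linarith [hn.2, hx.1]
  · have hanti : ∀ k, f^[k + 1] x ≤ f^[k] x := by
      intro k
      induction k with
      | zero => simpa using h
      | succ k ih =>
        rw [Function.iterate_succ_apply' f k, Function.iterate_succ_apply' f (k + 1)]
        exact hf.monotoneOn (hf.iterate_mem hx (k + 1)) (hf.iterate_mem hx k) ih
    rw [Finset.sum_congr rfl fun k _ => abs_of_nonpos (sub_nonpos.2 (hanti k)),
      Finset.sum_neg_distrib, Finset.sum_range_sub (fun k => f^[k] x)]
    simp only [Function.iterate_zero, id]
    linarith [hn.1, hx.2]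

theorem bddAbove_abs_derivWithin_iterate (hf : IsDiff01 f g) (n : ℕ) :
    BddAbove ((fun x => |derivWithin f^[n] (Icc (0 : ℝ) 1) x|) '' Icc (0 : ℝ) 1) := by
  obtain ⟨m, hm0, hm⟩ := hf.symm.exists_deriv_lower_bound
  refine ⟨(1 / m) ^ n, ?_⟩
  rintro _ ⟨x, hx, rfl⟩
  simp only [hf.derivWithin_iterate hx, Finset.abs_prod]
  calc _ ≤ ∏ k ∈ Finset.range n, 1 / m := by
        refine Finset.prod_le_prod (fun _ _ => abs_nonneg _) fun k _ => ?_
        have hk := hf.iterate_mem hx k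
        rw [abs_of_pos (hf.deriv_pos _ hk), le_div_iff₀ hm0]
        have h1 := hf.symm.deriv_mul_inv_deriv hk
        nlinarith [hm _ (hf.mapsTo hk), hf.deriv_pos _ hk]
    _ = _ := by simp

theorem deriv_pow_le_supAbsDeriv (hf : IsDiff01 f g) {p : ℝ} (hp : p ∈ Icc (0 : ℝ) 1)
    (hfp : f p = p) (n : ℕ) : derivWithin f (Icc 0 1) p ^ n ≤ supAbsDeriv f^[n] := by
  have h := le_csSup (hf.bddAbove_abs_derivWithin_iterate n) (mem_image_of_mem _ hp)
  refine le_trans ?_ h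
  simp only [hf.derivWithin_iterate hp, Function.iterate_fixed hfp, Finset.prod_const,
    Finset.card_range]
  exact le_abs_self _

theorem deriv_le_one_of_fixed (hf : IsDiff01 f g) {Γ : ℕ → ℝ}
    (hΓ : ∀ n, supAbsDeriv f^[n] ≤ Γ n)
    (hlim : Tendsto (fun n : ℕ => Γ n ^ (1 / (n : ℝ))) atTop (nhds 1)) {p : ℝ}
    (hp : p ∈ Icc (0 : ℝ) 1) (hfp : f p = p) : derivWithin f (Icc 0 1) p ≤ 1 := by
  refine ge_of_tendsto hlim ?_
  filter_upwards [eventually_ge_atTop 1] with n hn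
  have h0 := (hf.deriv_pos p hp).le
  calc derivWithin f (Icc 0 1) p = (derivWithin f (Icc 0 1) p ^ n) ^ (1 / (n : ℝ)) := by
        rw [one_div, Real.pow_rpow_inv_natCast h0 (by omega)]
    _ ≤ _ := Real.rpow_le_rpow (by positivity)
        ((hf.deriv_pow_le_supAbsDeriv hp hfp n).trans (hΓ n)) (by positivity)

/-- If `f'` has modulus of continuity `C * ω` and `f` is tangent to the
identity at its fixed points, then a small displacement forces a derivative close to `1`. -/
theorem deriv_sub_one_le_of_displacement_le (hf : IsDiff01 f g) {ω : ℝ → ℝ} (hω : IsModCont ω)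
    {C : ℝ} (hC0 : 0 < C)
    (hC : ∀ x ∈ Icc (0 : ℝ) 1, ∀ y ∈ Icc (0 : ℝ) 1,
      |derivWithin f (Icc 0 1) x - derivWithin f (Icc 0 1) y| ≤ C * ω |x - y|)
    (hfix : ∀ p ∈ Icc (0 : ℝ) 1, f p = p → derivWithin f (Icc 0 1) p = 1)
    {t : ℝ} (ht0 : 0 < t) (ht1 : t ≤ 1) {x : ℝ} (hx : x ∈ Icc (0 : ℝ) 1)
    (hd : |f x - x| ≤ t ^ 2) :
    derivWithin f (Icc 0 1) x - 1 ≤ t + C * ω t := by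
  have hclose : ∀ y ∈ Icc (0 : ℝ) 1, |x - y| ≤ t →
      derivWithin f (Icc 0 1) x ≤ derivWithin f (Icc 0 1) y + C * ω t := by
    intro y hy hxy
    have h1 := (le_abs_self _).trans (hC x hx y hy)
    have h2 : ω |x - y| ≤ ω t :=
      hω.monotoneOn ⟨abs_nonneg _, hxy.trans ht1⟩ ⟨ht0.le, ht1⟩ hxy
    have h3 := mul_le_mul_of_nonneg_left h2 hC0.le
    linarith
  by_cases hp : ∃ p ∈ Icc (0 : ℝ) 1, |x - p| ≤ t ∧ f p = p
  · obtain ⟨p, hpI, hxp, hfp⟩ := hp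
    have h1 := hclose p hpI hxp
    rw [hfix p hpI hfp] at h1
    linarith
  push Not at hp
  have hcont : ContinuousOn (fun y => f y - y) (Icc 0 1) :=
    hf.contDiffOn.continuousOn.sub continuousOn_id
  have hd' := abs_le.1 hd
  rcases le_total x (f x) with h | h
  · have hxt : 0 < x - t := by
      by_contra! hneg
      exact hp 0 (by simp) (by rw [sub_zero, abs_of_nonneg hx.1]; linarith) hf.map_zero
    have hxtI : x - t ∈ Icc (0 : ℝ) 1 := ⟨hxt.le, by linarith [hx.2]⟩
    have hpos : x - t < f (x - t) := by
      by_contra! hneg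
      obtain ⟨p, hpI, hp0⟩ := intermediate_value_Icc (by linarith : x - t ≤ x)
        (hcont.mono (Icc_subset_Icc hxtI.1 hx.2))
        (show (0 : ℝ) ∈ Icc _ _ from ⟨by linarith, by linarith⟩)
      refine hp p ⟨hxtI.1.trans hpI.1, hpI.2.trans hx.2⟩ ?_ (by simpa [sub_eq_zero] using hp0)
      rw [abs_of_nonneg (by linarith [hpI.2])]
      linarith [hpI.1]
    obtain ⟨ξ, hξ, he⟩ := hf.exists_slope_of_lt hxtI hx (by linarith)
    have h1 := hclose ξ ⟨hxt.le.trans hξ.1.le, hξ.2.le.trans hx.2⟩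
      (by rw [abs_of_nonneg (by linarith [hξ.2])]; linarith [hξ.1])
    have h2 : derivWithin f (Icc 0 1) ξ ≤ 1 + t := by
      refine le_of_mul_le_mul_right ?_ ht0
      rw [sub_sub_cancel] at he
      nlinarith
    linarith
  · have hxt : x + t < 1 := by
      by_contra! hneg
      exact hp 1 (by simp) (by rw [abs_of_nonpos (by linarith [hx.2])]; linarith) hf.map_one
    have hxtI : x + t ∈ Icc (0 : ℝ) 1 := ⟨by linarith [hx.1], hxt.le⟩
    have hneg : f (x + t) < x + t := by
      by_contra! hpos
      obtain ⟨p, hpI, hp0⟩ := intermediate_value_Icc (by linarith : x ≤ x + t)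
        (hcont.mono (Icc_subset_Icc hx.1 hxtI.2))
        (show (0 : ℝ) ∈ Icc _ _ from ⟨by linarith, by linarith⟩)
      refine hp p ⟨hx.1.trans hpI.1, hpI.2.trans hxtI.2⟩ ?_ (by simpa [sub_eq_zero] using hp0)
      rw [abs_of_nonpos (by linarith [hpI.1])]
      linarith [hpI.2]
    obtain ⟨ξ, hξ, he⟩ := hf.exists_slope_of_lt hx hxtI (by linarith)
    have h1 := hclose ξ ⟨hx.1.trans hξ.1.le, hξ.2.le.trans hxt.le⟩
      (by rw [abs_of_nonpos (by linarith [hξ.1])]; linarith [hξ.2])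
    have h2 : derivWithin f (Icc 0 1) ξ ≤ 1 + t := by
      refine le_of_mul_le_mul_right ?_ ht0
      rw [add_sub_cancel_left] at he
      nlinarith
    linarith

/-- Away from its fixed points, `log f'` is the logarithmic increment of the displacement up to
an error controlled by `ω`. -/
theorem log_deriv_le (hf : IsDiff01 f g) {ω : ℝ → ℝ} (hω : IsModCont ω) {C m : ℝ} (hC0 : 0 < C)
    (hC : ∀ x ∈ Icc (0 : ℝ) 1, ∀ y ∈ Icc (0 : ℝ) 1,
      |derivWithin f (Icc 0 1) x - derivWithin f (Icc 0 1) y| ≤ C * ω |x - y|)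
    (hm0 : 0 < m) (hm : ∀ x ∈ Icc (0 : ℝ) 1, m ≤ derivWithin f (Icc 0 1) x)
    {x : ℝ} (hx : x ∈ Icc (0 : ℝ) 1) (hd : 0 < |f x - x|) :
    0 < |f (f x) - f x| ∧ Real.log (derivWithin f (Icc 0 1) x) ≤
      Real.log |f (f x) - f x| - Real.log |f x - x| + C / m * ω |f x - x| := by
  have hfx := hf.mapsTo hx
  obtain ⟨ξ, hξ, hxξ, he⟩ := hf.exists_slope hx hfx
  have hF := hf.deriv_pos ξ hξ
  rw [he, abs_mul, abs_of_pos hF, Real.log_mul hF.ne' hd.ne']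
  refine ⟨by positivity, ?_⟩
  have hd1 : |f x - x| ≤ 1 := abs_le.2 ⟨by linarith [hfx.1, hx.2], by linarith [hfx.2, hx.1]⟩
  have h1 : derivWithin f (Icc 0 1) x - derivWithin f (Icc 0 1) ξ ≤ C * ω |f x - x| :=
    ((le_abs_self _).trans (hC x hx ξ hξ)).trans (mul_le_mul_of_nonneg_left
      (hω.monotoneOn ⟨abs_nonneg _, hxξ.trans hd1⟩ ⟨hd.le, hd1⟩ hxξ) hC0.le)
  have h0 := hω.nonneg _ ⟨hd.le, hd1⟩
  have hFx := hf.deriv_pos x hx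
  have h2 := Real.log_le_sub_one_of_pos (div_pos hFx hF)
  rw [Real.log_div hFx.ne' hF.ne'] at h2
  have h3 : derivWithin f (Icc 0 1) x / derivWithin f (Icc 0 1) ξ - 1 ≤ C / m * ω |f x - x| :=
    calc _ = (derivWithin f (Icc 0 1) x - derivWithin f (Icc 0 1) ξ) /
          derivWithin f (Icc 0 1) ξ := by field_simp
      _ ≤ C * ω |f x - x| / derivWithin f (Icc 0 1) ξ := by gcongr
      _ ≤ C * ω |f x - x| / m := by gcongr; exact hm ξ hξ
      _ = _ := by ring
  linarith

theorem sum_log_deriv_le (hf : IsDiff01 f g) {ω : ℝ → ℝ} (hω : IsModCont ω) {C m : ℝ}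
    (hC0 : 0 < C)
    (hC : ∀ x ∈ Icc (0 : ℝ) 1, ∀ y ∈ Icc (0 : ℝ) 1,
      |derivWithin f (Icc 0 1) x - derivWithin f (Icc 0 1) y| ≤ C * ω |x - y|)
    (hm0 : 0 < m) (hm : ∀ x ∈ Icc (0 : ℝ) 1, m ≤ derivWithin f (Icc 0 1) x)
    (hfix : ∀ p ∈ Icc (0 : ℝ) 1, f p = p → derivWithin f (Icc 0 1) p = 1)
    {t : ℝ} (ht0 : 0 < t) (ht1 : t ≤ 1) {x : ℝ} (hx : x ∈ Icc (0 : ℝ) 1) (n : ℕ) :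
    ∑ k ∈ Finset.range n, Real.log (derivWithin f (Icc 0 1) (f^[k] x)) ≤
      n * (t + C * ω t) + C / m * ∑ k ∈ Finset.range n, ω |f^[k + 1] x - f^[k] x| +
        Real.log (max 1 (|f^[n + 1] x - f^[n] x| / t ^ 2)) := by
  induction n with
  | zero => simpa using Real.log_nonneg (le_max_left _ _)
  | succ n ih =>
    have hn := hf.iterate_mem hx n
    have hn1 := hf.iterate_mem hx (n + 1)
    rw [Finset.sum_range_succ, Finset.sum_range_succ, mul_add]
    have hω0 : 0 ≤ ω t := hω.nonneg t ⟨ht0.le, ht1⟩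
    have hd1 : |f^[n + 1] x - f^[n] x| ≤ 1 :=
      abs_le.2 ⟨by linarith [hn1.1, hn.2], by linarith [hn1.2, hn.1]⟩
    have hωd := hω.nonneg _ ⟨abs_nonneg _, hd1⟩
    push_cast
    rcases le_or_gt |f^[n + 1] x - f^[n] x| (t ^ 2) with h | h
    · rw [max_eq_left ((div_le_one (by positivity)).2 h), Real.log_one] at ih
      have h2 := hf.deriv_sub_one_le_of_displacement_le hω hC0 hC hfix ht0 ht1 hn
        (by rwa [← Function.iterate_succ_apply' f n])
      have h3 := Real.log_le_sub_one_of_pos (hf.deriv_pos _ hn)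
      have h4 := Real.log_nonneg (le_max_left 1 (|f^[n + 1 + 1] x - f^[n + 1] x| / t ^ 2))
      have h5 : 0 ≤ C / m * ω |f^[n + 1] x - f^[n] x| := by positivity
      linarith
    · have hpos : 0 < |f^[n + 1] x - f^[n] x| := lt_trans (by positivity) h
      have h1 := hf.log_deriv_le hω hC0 hC hm0 hm hn
        (by rwa [← Function.iterate_succ_apply' f n])
      simp only [← Function.iterate_succ_apply' f] at h1
      have ht2 : 0 < t ^ 2 := by positivity
      rw [max_eq_right ((one_le_div ht2).2 h.le), Real.log_div hpos.ne' ht2.ne'] at ih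
      have h4 := Real.log_le_log (div_pos h1.1 ht2)
        (le_max_right 1 (|f^[n + 1 + 1] x - f^[n + 1] x| / t ^ 2))
      rw [Real.log_div h1.1.ne' ht2.ne'] at h4
      have h5 : 0 ≤ C * ω t := by positivity
      linarith [h1.2]

theorem exists_iterate_deriv_bound (hf : IsDiff01 f g) {ω : ℝ → ℝ} (hω : IsModCont ω)
    {α a : ℝ} (hα0 : 0 < α) (hα1 : α < 1) (ha0 : 0 < a) (ha1 : a < 1)
    (hdec : AntitoneOn (fun x => ω x / x ^ α) (Ioo 0 a)) (hfω : InDiffOmega ω f)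
    (hfix : ∀ p ∈ Icc (0 : ℝ) 1, f p = p → derivWithin f (Icc 0 1) p = 1) :
    ∃ K, 0 ≤ K ∧ ∀ n : ℕ, 1 ≤ n →
      supAbsDeriv f^[n] ≤ Real.exp (K * (n * ω (1 / (n : ℝ)))) := by
  suffices h : ∃ K, 0 ≤ K ∧ ∀ n : ℕ, 1 ≤ n → ∀ x ∈ Icc (0 : ℝ) 1,
      ∑ k ∈ Finset.range n, Real.log (derivWithin f (Icc 0 1) (f^[k] x)) ≤
        K * (n * ω (1 / (n : ℝ))) by
    obtain ⟨K, hK0, hK⟩ := h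
    refine ⟨K, hK0, fun n hn => csSup_le ((nonempty_Icc.2 zero_le_one).image _) ?_⟩
    rintro _ ⟨x, hx, rfl⟩
    have hpos : ∀ k, 0 < derivWithin f (Icc 0 1) (f^[k] x) := fun k =>
      hf.deriv_pos _ (hf.iterate_mem hx k)
    have h := hK n hn x hx
    rw [← Real.log_prod fun k _ => (hpos k).ne',
      Real.log_le_iff_le_exp (Finset.prod_pos fun k _ => hpos k)] at h
    simpa only [hf.derivWithin_iterate hx, abs_of_pos (Finset.prod_pos fun k _ => hpos k)] using h
  obtain ⟨C, hC0, hC⟩ := hfω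
  obtain ⟨m, hm0, hm⟩ := hf.exists_deriv_lower_bound
  have hone : (1 : ℝ) ∈ Icc (0 : ℝ) 1 := right_mem_Icc.2 zero_le_one
  rcases (hω.nonneg 1 hone).eq_or_lt with h1 | h1
  · refine ⟨0, le_rfl, fun n _ x hx => ?_⟩
    rw [zero_mul]
    refine Finset.sum_nonpos fun k _ => ?_
    have hk := hf.iterate_mem hx k
    have h2 := (le_abs_self _).trans (hC _ hk 0 (by simp))
    rw [hfix 0 (by simp) hf.map_zero, sub_zero, abs_of_nonneg hk.1] at h2
    have h3 := mul_le_mul_of_nonneg_left (hω.monotoneOn hk hone hk.2) hC0.le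
    rw [← h1, mul_zero] at h3
    linarith [Real.log_le_sub_one_of_pos (hf.deriv_pos _ hk)]
  obtain ⟨L, hL0, hL⟩ := hω.exists_log_le hα0 hα1 ha0 ha1 hdec h1
  refine ⟨2 / ω 1 + C + C / m * 2 + 2 * L, by positivity, fun n hn x hx => ?_⟩
  have hn0 : (0 : ℝ) < n := by exact_mod_cast hn
  have hn1 : (1 : ℝ) ≤ n := by exact_mod_cast hn
  set t : ℝ := 1 / n with ht
  have ht0 : 0 < t := by positivity
  have ht1 : t ≤ 1 := (div_le_one hn0).2 hn1
  have hsum := hf.sum_log_deriv_le hω hC0 hC hm0 hm hfix ht0 ht1 hx n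
  have hd : ∀ k, |f^[k + 1] x - f^[k] x| ≤ 1 := fun k =>
    abs_le.2 ⟨by linarith [(hf.iterate_mem hx k).2, (hf.iterate_mem hx (k + 1)).1],
      by linarith [(hf.iterate_mem hx k).1, (hf.iterate_mem hx (k + 1)).2]⟩
  have hωt := hω.nonneg t ⟨ht0.le, ht1⟩
  have hlin : t ≤ 2 / ω 1 * ω t := by
    rw [div_mul_eq_mul_div, le_div_iff₀ h1, mul_comm]
    exact hω.apply_one_mul_le ht0 ht1
  have hωsum : ∑ k ∈ Finset.range n, ω |f^[k + 1] x - f^[k] x| ≤ 2 * (n * ω t) :=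
    calc _ ≤ ∑ k ∈ Finset.range n, (n * |f^[k + 1] x - f^[k] x| + 1) * ω t := by
          refine Finset.sum_le_sum fun k _ => ?_
          have h := hω.le_div_add_one_mul ⟨abs_nonneg _, hd k⟩ ht0 ht1
          rwa [ht, div_div_eq_mul_div, div_one, mul_comm _ (n : ℝ), ← ht] at h
      _ = (n * ∑ k ∈ Finset.range n, |f^[k + 1] x - f^[k] x| + n) * ω t := by
          rw [← Finset.sum_mul, Finset.sum_add_distrib, ← Finset.mul_sum]
          simp
      _ ≤ (n * 1 + n) * ω t := by
          gcongr
          exact hf.sum_abs_iterate_sub_le hx n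
      _ = _ := by ring
  have hpot : Real.log (max 1 (|f^[n + 1] x - f^[n] x| / t ^ 2)) ≤ 2 * (L * (n * ω t)) := by
    have hle : max 1 (|f^[n + 1] x - f^[n] x| / t ^ 2) ≤ (n : ℝ) ^ 2 := by
      refine max_le (one_le_pow₀ hn1) ?_
      rw [ht, one_div, inv_pow, div_inv_eq_mul]
      exact mul_le_of_le_one_left (by positivity) (hd n)
    calc _ ≤ Real.log ((n : ℝ) ^ 2) :=
          Real.log_le_log (lt_of_lt_of_le one_pos (le_max_left _ _)) hle
      _ = 2 * Real.log n := by rw [Real.log_pow]; norm_num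
      _ ≤ _ := by gcongr; exact hL n hn
  have hA : (n : ℝ) * (t + C * ω t) ≤ n * (2 / ω 1 * ω t + C * ω t) := by gcongr
  have hB : C / m * ∑ k ∈ Finset.range n, ω |f^[k + 1] x - f^[k] x| ≤
      C / m * (2 * (n * ω t)) := by gcongr
  calc _ ≤ n * (2 / ω 1 * ω t + C * ω t) + C / m * (2 * (n * ω t)) + 2 * (L * (n * ω t)) := by
        linarith
    _ = _ := by ring

theorem inDiffOmega_symm (hf : IsDiff01 f g) {ω : ℝ → ℝ} (hω : IsModCont ω)
    (hfω : InDiffOmega ω f) : InDiffOmega ω g := by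
  obtain ⟨C, hC0, hC⟩ := hfω
  obtain ⟨m, hm0, hm⟩ := hf.exists_deriv_lower_bound
  have hG : ∀ x ∈ Icc (0 : ℝ) 1,
      derivWithin g (Icc 0 1) x = 1 / derivWithin f (Icc 0 1) (g x) := fun x hx =>
    eq_one_div_of_mul_eq_one_right (hf.deriv_mul_inv_deriv hx)
  refine ⟨C / m ^ 2 * (1 / m + 1), by positivity, fun x hx y hy => ?_⟩
  rcases eq_or_ne x y with rfl | hxy
  · simp [hω.map_zero]
  have hgx := hf.inv_mapsTo hx
  have hgy := hf.inv_mapsTo hy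
  have hd0 : 0 < |x - y| := abs_pos.2 (sub_ne_zero.2 hxy)
  have hd1 : |x - y| ≤ 1 := abs_le.2 ⟨by linarith [hx.1, hy.2], by linarith [hx.2, hy.1]⟩
  have hgd1 : |g x - g y| ≤ 1 :=
    abs_le.2 ⟨by linarith [hgx.1, hgy.2], by linarith [hgx.2, hgy.1]⟩
  have hωd := hω.nonneg _ ⟨hd0.le, hd1⟩
  have hlip : |g x - g y| / |x - y| ≤ 1 / m := by
    obtain ⟨ξ, hξ, -, he⟩ := hf.symm.exists_slope hy hx
    rw [he, abs_mul, mul_div_assoc, div_self hd0.ne', mul_one,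
      abs_of_pos (hf.symm.deriv_pos ξ hξ), hG ξ hξ]
    exact one_div_le_one_div_of_le hm0 (hm _ (hf.inv_mapsTo hξ))
  have hωg : ω |g x - g y| ≤ (1 / m + 1) * ω |x - y| :=
    (hω.le_div_add_one_mul ⟨abs_nonneg _, hgd1⟩ hd0 hd1).trans (by gcongr)
  have hFx := hm _ hgx
  have hFy := hm _ hgy
  have hFx0 := hf.deriv_pos _ hgx
  have hFy0 := hf.deriv_pos _ hgy
  rw [hG x hx, hG y hy, div_sub_div _ _ hFx0.ne' hFy0.ne', one_mul, mul_one, abs_div,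
    abs_of_pos (mul_pos hFx0 hFy0), abs_sub_comm]
  calc _ ≤ C * ((1 / m + 1) * ω |x - y|) / (m * m) := by
        gcongr
        exact (hC _ hgx _ hgy).trans (by gcongr)
    _ = _ := by ring

end IsDiff01

/-- **Theorem 5.** Let `ω` be a modulus of continuity such that `ω(x)/x^α` is decreasing
on `(0,a)` for some `0 < α < 1`, `0 < a < 1`. Then for every `f ∈ Diff₀^ω[0,1]` with
`γ(f) = 1`, `log Γ_n(f) ≤ C(f) · n · ω(1/n)` for all `n ∈ ℕ`. -/
theorem growth_gap_low_smoothness (ω : ℝ → ℝ) (hω : IsModCont ω)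
    (α a : ℝ) (hα0 : 0 < α) (hα1 : α < 1) (ha0 : 0 < a) (ha1 : a < 1)
    (hdec : AntitoneOn (fun x => ω x / x ^ α) (Set.Ioo 0 a))
    (f g : ℝ → ℝ) (hf : IsDiff01 f g) (hfω : InDiffOmega ω f) (hγ : GammaEqOne f g) :
    ∃ C > 0, ∀ n : ℕ, 1 ≤ n → Real.log (Gamma f g n) ≤ C * n * ω (1 / (n:ℝ)) := by
  have hf1 : ∀ p ∈ Icc (0 : ℝ) 1, f p = p → derivWithin f (Icc 0 1) p ≤ 1 := fun p hp hfp =>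
    hf.deriv_le_one_of_fixed (fun _ => le_max_left _ _) hγ hp hfp
  have hg1 : ∀ p ∈ Icc (0 : ℝ) 1, g p = p → derivWithin g (Icc 0 1) p ≤ 1 := fun p hp hgp =>
    hf.symm.deriv_le_one_of_fixed (fun _ => le_max_right _ _) hγ hp hgp
  have hprod : ∀ p ∈ Icc (0 : ℝ) 1, g p = p →
      derivWithin f (Icc 0 1) p * derivWithin g (Icc 0 1) p = 1 := fun p hp hgp => by
    simpa only [hgp] using hf.deriv_mul_inv_deriv hp
  have hfg : ∀ p ∈ Icc (0 : ℝ) 1, f p = p → g p = p := fun p hp hfp => by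
    simpa only [hfp] using hf.left_inv p hp
  have hgf : ∀ p ∈ Icc (0 : ℝ) 1, g p = p → f p = p := fun p hp hgp => by
    simpa only [hgp] using hf.right_inv p hp
  obtain ⟨K, hK0, hK⟩ := hf.exists_iterate_deriv_bound hω hα0 hα1 ha0 ha1 hdec hfω
    (fun p hp hfp => by
      nlinarith [hf1 p hp hfp, hg1 p hp (hfg p hp hfp), hprod p hp (hfg p hp hfp),
        hf.deriv_pos p hp])
  obtain ⟨L, hL0, hL⟩ := hf.symm.exists_iterate_deriv_bound hω hα0 hα1 ha0 ha1 hdec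
    (hf.inDiffOmega_symm hω hfω)
    (fun p hp hgp => by
      nlinarith [hf1 p hp (hgf p hp hgp), hg1 p hp hgp, hprod p hp hgp, hf.symm.deriv_pos p hp])
  refine ⟨K + L + 1, by positivity, fun n hn => ?_⟩
  have hn1 : (1 : ℝ) ≤ n := by exact_mod_cast hn
  have hω0 : 0 ≤ ω (1 / (n : ℝ)) :=
    hω.nonneg _ ⟨by positivity, (div_le_one (by linarith)).2 hn1⟩
  have hle : Gamma f g n ≤ Real.exp ((K + L + 1) * n * ω (1 / (n : ℝ))) := by
    rw [mul_assoc]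
    refine max_le ((hK n hn).trans ?_) ((hL n hn).trans ?_) <;>
    · gcongr
      linarith
  have h0 : 0 ≤ Gamma f g n := le_max_of_le_left (Real.sSup_nonneg (by
    rintro _ ⟨x, -, rfl⟩
    exact abs_nonneg _))
  rcases h0.eq_or_lt with h | h
  · rw [← h, Real.log_zero]
    positivity
  · exact (Real.log_le_iff_le_exp h).2 hle
end
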